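/- arXiv:math/0703837 — 2 statements merged into one kernel-verified Lean document; each statement's English description precedes it below -/
import Mathlib

section
/- (Deterministic core of Theorem 3.2(c), excessive case.) If ∫₀^∞ g(s) ds > 1, then there exists a unique κ > 0 such that ∫₀^∞ e^{−κs} g(s) ds = 1, and for this κ one has ∫₀^∞ s·e^{−κs} g(s) ds ∈ (0,∞) and e^{−κt}·M(t) converges as t → ∞ to the finite limit (∫₀^∞ e^{−κs} f(s) ds)·(∫₀^∞ e^{−κs} r(s)² ds) / (∫₀^∞ s·e^{−κs} g(s) ds). -/
open MeasureTheory Filter Set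

/-- Integration of `u ↦ ψ (t + u)` over `[-α, 0]` against a finite signed Borel
measure `ν`, realised via its Jordan decomposition:
`Gν α ν ψ t = ∫_{[-α,0]} ψ(t+u) ν(du)`. -/
noncomputable def Gν (α : ℝ) (ν : MeasureTheory.SignedMeasure ℝ) (ψ : ℝ → ℝ) (t : ℝ) : ℝ :=
  (∫ u in Set.Icc (-α) 0, ψ (t + u) ∂ν.toJordanDecomposition.posPart) -
  (∫ u in Set.Icc (-α) 0, ψ (t + u) ∂ν.toJordanDecomposition.negPart)


structure LB (φ : ℝ → ℝ) : Prop where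
  meas : Measurable φ
  nn : ∀ t, 0 ≤ φ t
  neg : ∀ t < 0, φ t = 0
  bdd : ∀ T : ℝ, ∃ K : ℝ, ∀ t ≤ T, φ t ≤ K

structure Dens (h : ℝ → ℝ) : Prop where
  meas : Measurable h
  nn : ∀ t, 0 ≤ h t
  neg : ∀ t ≤ 0, h t = 0
  int : Integrable h

lemma LB.sq {φ : ℝ → ℝ} (hφ : LB φ) : LB (fun t => φ t ^ 2) where
  meas := hφ.meas.pow_const 2
  nn t := sq_nonneg _
  neg t ht := by simp [hφ.neg t ht]
  bdd T := by
    obtain ⟨K, hK⟩ := hφ.bdd T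
    exact ⟨K ^ 2, fun t ht => by have := hφ.nn t; have := hK t ht; gcongr⟩

lemma LB.ii {φ : ℝ → ℝ} (hφ : LB φ) (a b : ℝ) : IntervalIntegrable φ volume a b := by
  obtain ⟨K, hK⟩ := hφ.bdd (max a b)
  refine (intervalIntegrable_const (c := K)).mono_fun' hφ.meas.aestronglyMeasurable ?_
  refine (ae_restrict_iff' measurableSet_uIoc).2 (Eventually.of_forall fun t ht => ?_)
  beta_reduce
  rw [Real.norm_eq_abs, abs_of_nonneg (hφ.nn t)]
  exact hK t (ht.2)

lemma LB.conv_int {h φ : ℝ → ℝ} (hh : Dens h) (hφ : LB φ) (t : ℝ) :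
    Integrable (fun s => h s * φ (t - s)) := by
  obtain ⟨K, hK⟩ := hφ.bdd t
  refine (hh.int.mul_const K).mono' (hh.meas.mul (hφ.meas.comp (measurable_const.sub measurable_id))).aestronglyMeasurable ?_
  refine Eventually.of_forall fun s => ?_
  rw [Real.norm_eq_abs, abs_of_nonneg (mul_nonneg (hh.nn _) (hφ.nn _))]
  rcases le_or_gt s 0 with hs | hs
  · simp [hh.neg s hs]
  · exact mul_le_mul_of_nonneg_left (hK _ (by linarith)) (hh.nn _)

lemma LB.conv_prod {h φ : ℝ → ℝ} (hh : Dens h) (hφ : LB φ) (T : ℝ) :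
    Integrable (Function.uncurry fun t s => h s * φ (t - s)) ((volume.restrict (Ioc 0 T)).prod volume) := by
  obtain ⟨K, hK⟩ := hφ.bdd T
  have h1 : Integrable (fun _ : ℝ => K) (volume.restrict (Ioc 0 T)) := integrable_const _
  have h2 := h1.mul_prod hh.int
  refine h2.mono' ?_ ?_
  · exact ((hh.meas.comp measurable_snd).mul (hφ.meas.comp (measurable_fst.sub measurable_snd))).aestronglyMeasurable
  · have : ∀ᵐ p : ℝ × ℝ ∂((volume.restrict (Ioc 0 T)).prod volume), p.1 ∈ Ioc 0 T := by
      exact Measure.quasiMeasurePreserving_fst.ae (ae_restrict_mem measurableSet_Ioc)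
    filter_upwards [this] with p hp
    simp only [Function.uncurry]
    rw [Real.norm_eq_abs, abs_of_nonneg (mul_nonneg (hh.nn _) (hφ.nn _)), mul_comm K]
    rcases le_or_gt p.2 0 with hs | hs
    · simp [hh.neg p.2 hs]
    · exact mul_le_mul_of_nonneg_left (hK _ (by linarith [hp.2])) (hh.nn _)

lemma LB.conv_id {h φ : ℝ → ℝ} (hh : Dens h) (hφ : LB φ) (h1 : ∫ s, h s = 1) {T : ℝ} (hT : 0 ≤ T) :
    Integrable (fun s => h s * ∫ u in (T - s)..T, φ u) ∧
    IntervalIntegrable (fun t => ∫ s, h s * φ (t - s)) volume 0 T ∧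
    ∫ t in (0:ℝ)..T, (∫ s, h s * φ (t - s)) =
      (∫ t in (0:ℝ)..T, φ t) - ∫ s, h s * ∫ u in (T - s)..T, φ u := by
  have hp := hφ.conv_prod hh T
  have key : ∀ s, ∫ t in Ioc 0 T, h s * φ (t - s) =
      h s * (∫ t in (0:ℝ)..T, φ t) - h s * ∫ u in (T - s)..T, φ u := by
    intro s
    rw [integral_const_mul, ← intervalIntegral.integral_of_le hT,
      intervalIntegral.integral_comp_sub_right, ← mul_sub]
    rcases le_or_gt s 0 with hs | hs
    · simp [hh.neg s hs]
    congr 1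
    have e1 : ∫ u in (0 - s)..0, φ u = 0 := by
      rw [intervalIntegral.integral_of_le (by linarith), integral_Ioc_eq_integral_Ioo]
      exact setIntegral_eq_zero_of_forall_eq_zero fun u hu => hφ.neg u hu.2
    rw [← intervalIntegral.integral_add_adjacent_intervals (hφ.ii (0 - s) 0) (hφ.ii 0 (T - s)), e1,
      ← intervalIntegral.integral_add_adjacent_intervals (hφ.ii 0 (T - s)) (hφ.ii (T-s) T)]
    ring
  have hi := hp.integral_prod_right
  simp only [Function.uncurry] at hi
  simp only [key] at hi
  have hi2 : Integrable (fun s => h s * ∫ u in (T - s)..T, φ u) := by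
    have := (hh.int.mul_const (∫ t in (0:ℝ)..T, φ t)).sub hi
    refine this.congr (Eventually.of_forall fun s => ?_)
    simp
  refine ⟨hi2, ?_, ?_⟩
  · rw [intervalIntegrable_iff_integrableOn_Ioc_of_le hT]
    exact hp.integral_prod_left
  · rw [intervalIntegral.integral_of_le hT, integral_integral_swap hp]
    simp only [key]
    rw [integral_sub (hh.int.mul_const _) hi2, integral_mul_const, h1, one_mul]

lemma translate_L1 {h : ℝ → ℝ} (hh : Integrable h) :
    Tendsto (fun a => ∫ s, |h (a + s) - h s|) (nhds 0) (nhds 0) := by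
  have hm : MemLp h 1 volume := memLp_one_iff_integrable.2 hh
  have : Fact ((1:ENNReal) ≠ ⊤) := ⟨ENNReal.one_ne_top⟩
  have hc : Continuous (fun a : ℝ => DomAddAct.mk a +ᵥ hm.toLp h) := by
    have : Continuous (fun a : ℝ => DomAddAct.mk a) := DomAddAct.continuous_mk
    exact this.vadd continuous_const
  have h2 := (hc.dist (continuous_const (y := hm.toLp h))).tendsto 0
  have e0 : DomAddAct.mk (0:ℝ) +ᵥ hm.toLp h = hm.toLp h := by simp
  simp only [e0, dist_self] at h2
  refine h2.congr fun a => ?_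
  have hi : Integrable (fun s => h (a + s)) := hh.comp_add_left a
  rw [DomAddAct.mk_vadd_toLp, dist_edist, Lp.edist_toLp_toLp, eLpNorm_one_eq_lintegral_enorm,
    ← integral_norm_eq_lintegral_enorm]
  · rfl
  · exact (hi.sub hh).aestronglyMeasurable

lemma unif_conv {h z : ℝ → ℝ} (hh : Dens h) (hz : LB z) {B : ℝ} (hB : ∀ t, z t ≤ B) :
    UniformContinuous (fun t => ∫ s, h s * z (t - s)) := by
  have hB0 : 0 ≤ B := (hz.nn 0).trans (hB 0)
  have e : ∀ t, ∫ s, h s * z (t - s) = ∫ s, h (t - s) * z s := by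
    intro t
    rw [← integral_sub_left_eq_self _ volume t]
    simp
  have ei : ∀ t, Integrable (fun s => h (t - s) * z s) := by
    intro t
    have := (hz.conv_int hh t).comp_sub_left t
    simpa using this
  simp only [e]
  rw [Metric.uniformContinuous_iff]
  intro ε hε
  obtain ⟨δ, hδ, hd⟩ := Metric.tendsto_nhds_nhds.1 (translate_L1 hh.int) (ε / (B + 1)) (by positivity)
  refine ⟨δ, hδ, fun {t t'} htt => ?_⟩
  have h1 := hd (x := t - t') (by rwa [Real.dist_eq, sub_zero, ← Real.dist_eq])
  rw [Real.dist_eq, sub_zero, abs_of_nonneg (integral_nonneg fun _ => abs_nonneg _),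
    ← integral_sub_left_eq_self _ volume t'] at h1
  rw [Real.dist_eq, ← integral_sub (ei t) (ei t')]
  have hI : Integrable (fun s => |h (t - s) - h (t' - s)|) :=
    ((hh.int.comp_sub_left t).sub (hh.int.comp_sub_left t')).abs
  calc |∫ s, (h (t - s) * z s - h (t' - s) * z s)|
      ≤ ∫ s, |h (t - s) * z s - h (t' - s) * z s| := abs_integral_le_integral_abs
    _ ≤ ∫ s, |h (t - s) - h (t' - s)| * B := by
        refine integral_mono ((ei t).sub (ei t')).abs (hI.mul_const _) fun s => ?_
        beta_reduce
        rw [← sub_mul, abs_mul, abs_of_nonneg (hz.nn s)]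
        exact mul_le_mul_of_nonneg_left (hB s) (abs_nonneg _)
    _ = (∫ s, |h (t - s) - h (t' - s)|) * B := integral_mul_const _ _
    _ < ε := by
        have e3 : (fun s => |h (t - t' + (t' - s)) - h (t' - s)|) = fun s => |h (t - s) - h (t' - s)| := by
          ext s; congr 3; ring
        rw [e3, lt_div_iff₀ (by positivity)] at h1
        have : 0 ≤ ∫ s, |h (t - s) - h (t' - s)| := integral_nonneg fun _ => abs_nonneg _
        nlinarith

lemma barbalat {u : ℝ → ℝ} (hu : UniformContinuous u) (hi : IntegrableOn (fun t => u t ^ 2) (Ioi 0)) :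
    Tendsto u atTop (nhds 0) := by
  rw [Metric.tendsto_atTop]
  intro ε hε
  obtain ⟨δ, hδ, hd⟩ := Metric.uniformContinuous_iff.1 hu (ε / 2) (by positivity)
  have ht := intervalIntegral_tendsto_integral_Ioi 0 hi tendsto_id
  have ht2 := ht.comp (tendsto_atTop_add_const_right atTop (δ/2) tendsto_id)
  have ht3 := ht2.sub ht
  rw [sub_self] at ht3
  obtain ⟨N, hN⟩ := (ht3.eventually (gt_mem_nhds (show 0 < (ε/2)^2 * (δ/2) by positivity))).exists_forall_of_atTop
  refine ⟨max N 0, fun t htN => ?_⟩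
  have h1 := hN t (le_of_max_le_left htN)
  have ht0 : 0 ≤ t := le_of_max_le_right htN
  simp only [Function.comp, id] at h1
  have hc : Continuous (fun t => u t ^ 2) := hu.continuous.pow 2
  rw [intervalIntegral.integral_interval_sub_left (hc.intervalIntegrable _ _) (hc.intervalIntegrable _ _)] at h1
  by_contra hcon
  rw [Real.dist_eq, sub_zero, not_lt] at hcon
  have h2 : ∫ _ in t..(t+δ/2), (ε/2)^2 ≤ ∫ v in t..(t + δ/2), u v ^ 2 := by
    refine intervalIntegral.integral_mono_on (by linarith) (by simp) (hc.intervalIntegrable _ _) ?_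
    intro v hv
    have : dist (u t) (u v) < ε/2 := hd (by rw [Real.dist_eq, abs_lt]; constructor <;> linarith [hv.1, hv.2])
    rw [Real.dist_eq] at this
    rw [← sq_abs (u v)]
    have := abs_sub_abs_le_abs_sub (u t) (u v)
    gcongr
    linarith
  simp at h2
  linarith

structure Force (f : ℝ → ℝ) : Prop where
  meas : Measurable f
  nn : ∀ t, 0 ≤ f t
  bdd : ∃ K, ∀ t, f t ≤ K
  int : Integrable f
  lim : Tendsto f atTop (nhds 0)

lemma mass_id {h f z : ℝ → ℝ} (hh : Dens h) (h1 : ∫ s, h s = 1) (hf : Force f) (hz : LB z)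
    (hren : ∀ t, z t = f t + ∫ s, h s * z (t - s)) {T : ℝ} (hT : 0 ≤ T) :
    ∫ t in (0:ℝ)..T, f t = ∫ s, h s * ∫ u in (T - s)..T, z u := by
  obtain ⟨_, hi, he⟩ := hz.conv_id hh h1 hT
  have : ∫ t in (0:ℝ)..T, z t = (∫ t in (0:ℝ)..T, f t) + ∫ t in (0:ℝ)..T, ∫ s, h s * z (t - s) := by
    rw [← intervalIntegral.integral_add hf.int.intervalIntegrable hi]
    exact intervalIntegral.integral_congr fun t _ => hren t
  linarith

lemma exists_half {h : ℝ → ℝ} (hh : Dens h) (h1 : ∫ s, h s = 1) :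
    ∃ δ : ℝ, 0 < δ ∧ ∫ s in Ioi δ, h s = 1 / 2 := by
  have hI : ∫ s in Ioi 0, h s = 1 := by
    rw [← h1]
    exact setIntegral_eq_integral_of_forall_compl_eq_zero fun s hs => hh.neg s (not_lt.1 hs)
  have hc : Continuous (fun δ => ∫ s in (0:ℝ)..δ, h s) :=
    intervalIntegral.continuous_primitive (fun a b => hh.int.intervalIntegrable) 0
  have ht := intervalIntegral_tendsto_integral_Ioi 0 hh.int.integrableOn tendsto_id
  rw [hI] at ht
  obtain ⟨N, hN⟩ := (ht.eventually (lt_mem_nhds (show (1/2:ℝ) < 1 by norm_num))).exists_forall_of_atTop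
  have hN' := hN (max N 0) (le_max_left _ _)
  obtain ⟨δ, hδ, he⟩ := intermediate_value_Icc (le_max_right N 0) hc.continuousOn
    (show (1/2:ℝ) ∈ Icc _ _ from ⟨by simp, hN'.le⟩)
  have hδ0 : 0 < δ := by
    rcases hδ.1.lt_or_eq with h | h
    · exact h
    · rw [← h] at he; simp at he
  refine ⟨δ, hδ0, ?_⟩
  have := intervalIntegral.integral_interval_add_Ioi (a := 0) (b := δ) hh.int.integrableOn hh.int.integrableOn
  beta_reduce at he
  linarith

lemma z_bdd {h f z : ℝ → ℝ} (hh : Dens h) (h1 : ∫ s, h s = 1) (hK : ∃ K, ∀ s, h s ≤ K)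
    (hf : Force f) (hz : LB z)
    (hren : ∀ t, z t = f t + ∫ s, h s * z (t - s)) : ∃ B, ∀ t, z t ≤ B := by
  obtain ⟨δ, hδ, hh2⟩ := exists_half hh h1
  obtain ⟨K, hK⟩ := hK
  obtain ⟨F, hF⟩ := hf.bdd
  have hK0 : 0 ≤ K := (hh.nn 0).trans (hK 0)
  have hF0 : 0 ≤ F := (hf.nn 0).trans (hF 0)
  set A := ∫ t, f t with hA
  have hA0 : 0 ≤ A := integral_nonneg hf.nn
  -- window bound
  have hwin : ∀ T, 0 ≤ T → ∫ u in (T - δ)..T, z u ≤ 2 * A := by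
    intro T hT
    obtain ⟨hi, _, _⟩ := hz.conv_id hh h1 hT
    have e1 := mass_id hh h1 hf hz hren hT
    have e2 : ∫ t in (0:ℝ)..T, f t ≤ A := by
      rw [intervalIntegral.integral_of_le hT]
      exact setIntegral_le_integral hf.int (Eventually.of_forall hf.nn)
    have nn : ∀ s, 0 ≤ h s * ∫ u in (T - s)..T, z u := by
      intro s
      rcases le_or_gt s 0 with hs | hs
      · simp [hh.neg s hs]
      · exact mul_nonneg (hh.nn _) (intervalIntegral.integral_nonneg (by linarith) fun u _ => hz.nn u)
    have e3 : ∫ s in Ioi δ, h s * (∫ u in (T - δ)..T, z u) ≤ ∫ s, h s * ∫ u in (T - s)..T, z u := by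
      refine le_trans ?_ (setIntegral_le_integral (s := Ioi δ) hi (Eventually.of_forall nn))
      refine setIntegral_mono_on (hh.int.mul_const _).integrableOn hi.integrableOn measurableSet_Ioi ?_
      intro s hs
      rw [mem_Ioi] at hs
      refine mul_le_mul_of_nonneg_left ?_ (hh.nn s)
      exact intervalIntegral.integral_mono_interval (by linarith) (by linarith) le_rfl
        (Eventually.of_forall hz.nn) (hz.ii _ _)
    rw [integral_mul_const, hh2] at e3
    linarith
  have main : ∀ T, 0 ≤ T → ∀ S, 0 ≤ S → (∀ t ≤ T, z t ≤ S) → ∀ t ≤ T, z t ≤ F + 2 * K * A + S / 2 := by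
    intro T hT S hS0 hS t ht
    rcases lt_or_ge t 0 with h0 | h0
    · rw [hz.neg t h0]; positivity
    rw [hren t]
    have hi := hz.conv_int hh t
    have e1 : ∫ s, h s * z (t - s) = (∫ s in (0:ℝ)..δ, h s * z (t - s)) + ∫ s in Ioi δ, h s * z (t - s) := by
      rw [intervalIntegral.integral_interval_add_Ioi hi.integrableOn hi.integrableOn]
      refine (setIntegral_eq_integral_of_forall_compl_eq_zero fun s hs => ?_).symm
      rw [hh.neg s (not_lt.1 hs), zero_mul]
    have e2 : ∫ s in (0:ℝ)..δ, h s * z (t - s) ≤ K * (2 * A) := by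
      have : ∫ s in (0:ℝ)..δ, h s * z (t - s) ≤ ∫ s in (0:ℝ)..δ, K * z (t - s) := by
        refine intervalIntegral.integral_mono_on hδ.le hi.intervalIntegrable ?_ ?_
        · refine IntervalIntegrable.const_mul ?_ K
          have := (hz.ii (t - 0) (t - δ)).comp_sub_left t
          simpa using this
        · intro s _
          exact mul_le_mul_of_nonneg_right (hK s) (hz.nn _)
      refine this.trans ?_
      rw [intervalIntegral.integral_const_mul, intervalIntegral.integral_comp_sub_left, sub_zero]
      exact mul_le_mul_of_nonneg_left (hwin t h0) hK0
    have e3 : ∫ s in Ioi δ, h s * z (t - s) ≤ 1 / 2 * S := by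
      rw [← hh2, ← integral_mul_const]
      refine setIntegral_mono_on hi.integrableOn (hh.int.mul_const _).integrableOn measurableSet_Ioi ?_
      intro s hs
      rw [mem_Ioi] at hs
      exact mul_le_mul_of_nonneg_left (hS _ (by linarith)) (hh.nn s)
    linarith [hF t]
  set D := F + 2 * K * A with hD
  have hD0 : 0 ≤ D := by positivity
  refine ⟨2 * D, fun t => ?_⟩
  -- the supremum on (-∞, T]
  have hbd : BddAbove (z '' Iic (max t 0)) := by
    obtain ⟨K', hK'⟩ := hz.bdd (max t 0)
    exact ⟨K', by rintro _ ⟨s, hs, rfl⟩; exact hK' s hs⟩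
  set S := sSup (z '' Iic (max t 0)) with hSdef
  have hS : ∀ s ≤ max t 0, z s ≤ S := fun s hs => le_csSup hbd ⟨s, hs, rfl⟩
  have hS0 : 0 ≤ S := (hz.nn 0).trans (hS 0 (le_max_right _ _))
  have h3 := main (max t 0) (le_max_right _ _) S hS0 hS
  have h4 : S ≤ D + S / 2 := csSup_le ⟨_, ⟨t, mem_Iic.2 (le_max_left _ _), rfl⟩⟩ (by rintro _ ⟨s, hs, rfl⟩; exact h3 s hs)
  linarith [hS t (le_max_left _ _)]

lemma energy {h f z : ℝ → ℝ} (hh : Dens h) (h1 : ∫ s, h s = 1)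
    (hf : Force f) (hz : LB z) {B : ℝ} (hB : ∀ t, z t ≤ B)
    (hren : ∀ t, z t = f t + ∫ s, h s * z (t - s)) :
    ∀ᵐ s, IntegrableOn (fun t => h s * (z (t - s) - ∫ v, h v * z (t - v)) ^ 2) (Ioi 0) := by
  have huc := unif_conv hh hz hB
  set w : ℝ → ℝ := fun t => ∫ v, h v * z (t - v) with hw
  have hB0 : 0 ≤ B := (hz.nn 0).trans (hB 0)
  have hw0 : ∀ t, 0 ≤ w t := fun t => integral_nonneg fun v => mul_nonneg (hh.nn _) (hz.nn _)
  have hwz : ∀ t, w t ≤ z t := fun t => by rw [hren t]; linarith [hf.nn t]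
  have hexp : ∀ t s, h s * (z (t - s) - w t) ^ 2 =
      h s * (z (t - s))^2 - 2 * w t * (h s * z (t - s)) + w t ^ 2 * h s := by intros; ring
  have hintg : ∀ t, Integrable (fun s => h s * (z (t - s) - w t) ^ 2) := by
    intro t
    simp only [hexp]
    exact ((hz.sq.conv_int hh t).sub ((hz.conv_int hh t).const_mul _)).add (hh.int.const_mul _)
  have hV : ∀ t, ∫ s, h s * (z (t - s) - w t) ^ 2 = (∫ s, h s * (z (t - s))^2) - w t ^ 2 := by
    intro t
    simp only [hexp]
    have hq : Integrable (fun s => h s * (z (t - s))^2 - 2 * w t * (h s * z (t - s))) :=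
      (hz.sq.conv_int hh t).sub ((hz.conv_int hh t).const_mul _)
    rw [integral_add hq (hh.int.const_mul _),
      integral_sub (hz.sq.conv_int hh t) ((hz.conv_int hh t).const_mul _), integral_const_mul,
      integral_const_mul, h1]
    change _ - 2 * w t * w t + _ = _
    ring
  have hnn : ∀ t s, 0 ≤ h s * (z (t - s) - w t) ^ 2 := fun t s => mul_nonneg (hh.nn _) (sq_nonneg _)
  have hprod : Integrable (Function.uncurry fun t s => h s * (z (t - s) - w t) ^ 2)
      ((volume.restrict (Ioi 0)).prod volume) := by
    have hmeas : Measurable (Function.uncurry fun t s => h s * (z (t - s) - w t) ^ 2) :=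
      (hh.meas.comp measurable_snd).mul (((hz.meas.comp (measurable_fst.sub measurable_snd)).sub
        (huc.continuous.measurable.comp measurable_fst)).pow_const 2)
    rw [integrable_prod_iff hmeas.aestronglyMeasurable]
    refine ⟨Eventually.of_forall hintg, ?_⟩
    simp only [Function.uncurry, Real.norm_eq_abs, abs_of_nonneg (hnn _ _), hV]
    have hii : ∀ T, 0 ≤ T → IntervalIntegrable (fun t => (∫ s, h s * (z (t - s))^2) - w t ^ 2) volume 0 T := by
      intro T hT
      exact (hz.sq.conv_id hh h1 hT).2.1.sub ((huc.continuous.pow 2).intervalIntegrable _ _)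
    refine integrableOn_Ioi_of_intervalIntegral_norm_bounded (l := atTop) (b := fun n : ℕ => (n:ℝ))
      (2 * B * ∫ t, f t) 0 (fun n => ?_) tendsto_natCast_atTop_atTop (Eventually.of_forall fun n => ?_)
    · have := hii n n.cast_nonneg
      rwa [intervalIntegrable_iff_integrableOn_Ioc_of_le n.cast_nonneg] at this
    · have hT : (0:ℝ) ≤ n := n.cast_nonneg
      obtain ⟨hi, hi2, he⟩ := hz.sq.conv_id hh h1 hT
      have e0 : ∀ t, ‖(∫ s, h s * (z (t - s))^2) - w t ^ 2‖ = (∫ s, h s * (z (t - s))^2) - w t ^ 2 := by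
        intro t
        rw [← hV, Real.norm_eq_abs, abs_of_nonneg (integral_nonneg (hnn t))]
      simp only [e0]
      have hwi : IntervalIntegrable (fun t => w t ^ 2) volume 0 n := (huc.continuous.pow 2).intervalIntegrable _ _
      rw [intervalIntegral.integral_sub hi2 hwi, he]
      have nn : 0 ≤ ∫ s, h s * ∫ u in ((n:ℝ) - s)..n, z u ^ 2 := by
        refine integral_nonneg fun s => ?_
        beta_reduce
        rcases le_or_gt s 0 with hs | hs
        · simp [hh.neg s hs]
        · exact mul_nonneg (hh.nn _) (intervalIntegral.integral_nonneg (by linarith) fun u _ => sq_nonneg _)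
      have e1 : (∫ t in (0:ℝ)..n, z t ^ 2) - ∫ t in (0:ℝ)..n, w t ^ 2 ≤ 2 * B * ∫ t in (0:ℝ)..n, f t := by
        rw [← intervalIntegral.integral_sub (hz.sq.ii _ _) hwi, ← intervalIntegral.integral_const_mul]
        refine intervalIntegral.integral_mono_on hT ((hz.sq.ii _ _).sub hwi)
          (hf.int.intervalIntegrable.const_mul _) fun t _ => ?_
        have e : z t = f t + w t := hren t
        nlinarith [hf.nn t, hB t, hwz t, hw0 t]
      have e2 : ∫ t in (0:ℝ)..n, f t ≤ ∫ t, f t := by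
        rw [intervalIntegral.integral_of_le hT]
        exact setIntegral_le_integral hf.int (Eventually.of_forall hf.nn)
      have : 2 * B * ∫ t in (0:ℝ)..n, f t ≤ 2 * B * ∫ t, f t := by gcongr
      linarith
  exact hprod.prod_left_ae

open scoped Pointwise in
lemma shift_lim {h f z : ℝ → ℝ} (hh : Dens h) (h1 : ∫ s, h s = 1)
    (hf : Force f) (hz : LB z) {B : ℝ} (hB : ∀ t, z t ≤ B)
    (hren : ∀ t, z t = f t + ∫ s, h s * z (t - s)) (a : ℝ) :
    Tendsto (fun t => (∫ v, h v * z (t + a - v)) - ∫ v, h v * z (t - v)) atTop (nhds 0) := by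
  have huc := unif_conv hh hz hB
  have hen := energy hh h1 hf hz hB hren
  set w : ℝ → ℝ := fun t => ∫ v, h v * z (t - v) with hw
  let G : AddSubgroup ℝ :=
    { carrier := {a | Tendsto (fun t => w (t + a) - w t) atTop (nhds 0)}
      zero_mem' := by simp
      add_mem' := by
        intro a b ha hb
        have := (ha.comp (tendsto_atTop_add_const_right atTop b tendsto_id)).add hb
        simp only [mem_ofPred_eq, add_zero] at this ⊢
        refine this.congr fun t => ?_
        simp only [Function.comp, id]
        rw [show t + b + a = t + (a + b) by ring]; ring
      neg_mem' := by
        intro a ha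
        have := (ha.comp (tendsto_atTop_add_const_right atTop (-a) tendsto_id)).neg
        simp only [mem_ofPred_eq, neg_zero] at this ⊢
        refine this.congr fun t => ?_
        simp [Function.comp] }
  have hae : ∀ᵐ s, 0 < h s → s ∈ G := by
    filter_upwards [hen] with s hs hpos
    suffices -s ∈ G by simpa using this
    have hs' : IntegrableOn (fun t => (z (t - s) - w t) ^ 2) (Ioi 0) := by
      have := hs.const_mul (h s)⁻¹
      refine this.congr (Eventually.of_forall fun t => ?_)
      beta_reduce
      rw [inv_mul_cancel_left₀ hpos.ne']
    refine barbalat ?_ ?_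
    · exact (huc.comp (uniformContinuous_id.add uniformContinuous_const)).sub huc
    · obtain ⟨F, hF⟩ := hf.bdd
      have hfi : Integrable (fun t => f (t - s) ^ 2) := by
        refine ((hf.int.mul_const F).mono' (hf.meas.pow_const 2).aestronglyMeasurable
          (Eventually.of_forall fun t => ?_)).comp_sub_right s
        rw [Real.norm_eq_abs, abs_of_nonneg (sq_nonneg _), sq]
        exact mul_le_mul_of_nonneg_left (hF t) (hf.nn t)
      refine ((hs'.const_mul 2).add (hfi.integrableOn.const_mul 2)).mono' ?_ ?_
      · exact (((huc.continuous.comp (continuous_id.add continuous_const)).sub huc.continuous).pow 2).aestronglyMeasurable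
      · refine Eventually.of_forall fun t => ?_
        have e : z (t - s) = f (t - s) + w (t - s) := hren _
        simp only [Pi.add_apply, ← sub_eq_add_neg]
        rw [Real.norm_eq_abs, abs_of_nonneg (sq_nonneg _), e]
        nlinarith [sq_nonneg (2 * f (t - s) + (w (t - s) - w t))]
  -- Steinhaus
  have hpos : 0 < volume {s | 0 < h s} := by
    rw [pos_iff_ne_zero]
    intro h0
    have : h =ᵐ[volume] 0 := by
      have h2 : ∀ᵐ s, ¬ (0 < h s) := by
        rw [ae_iff]; simpa using h0
      filter_upwards [h2] with s hs
      exact le_antisymm (not_lt.1 hs) (hh.nn s)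
    rw [integral_congr_ae this] at h1
    simp at h1
  set N := {s | ¬ (0 < h s → s ∈ G)} with hN
  have hN0 : volume (toMeasurable volume N) = 0 := by rw [measure_toMeasurable]; exact hae
  have hE : MeasurableSet ({s | 0 < h s} \ toMeasurable volume N) :=
    (measurableSet_lt measurable_const hh.meas).diff (measurableSet_toMeasurable _ _)
  have hEpos : 0 < volume ({s | 0 < h s} \ toMeasurable volume N) := by
    rwa [measure_sdiff_null hN0]
  have hst := MeasureTheory.Measure.sub_mem_nhds_zero_of_addHaar_pos volume _ hE hEpos
  have hsub : ({s | 0 < h s} \ toMeasurable volume N) - ({s | 0 < h s} \ toMeasurable volume N) ⊆ (G : Set ℝ) := by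
    have : ∀ s ∈ ({s | 0 < h s} \ toMeasurable volume N), s ∈ G := by
      intro s hs
      by_contra hc
      exact hs.2 (subset_toMeasurable _ _ (fun hh => hc (hh hs.1)))
    rintro _ ⟨s, hs, t, ht, rfl⟩
    exact G.sub_mem (this s hs) (this t ht)
  have hG : (G : Set ℝ) ∈ nhds 0 := mem_of_superset hst hsub
  have hall : a ∈ G := by
    have ht : Tendsto (fun n : ℕ => a / (n:ℝ)) atTop (nhds 0) := tendsto_const_div_atTop_nhds_zero_nat a
    obtain ⟨n, hn, hn1⟩ := ((ht.eventually hG).and (eventually_ge_atTop 1)).exists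
    have := G.nsmul_mem hn n
    rwa [nsmul_eq_mul, mul_div_cancel₀] at this
    positivity
  exact hall

theorem renewal {h f z : ℝ → ℝ} (hh : Dens h) (h1 : ∫ s, h s = 1) (hK : ∃ K, ∀ s, h s ≤ K)
    (hm : Integrable (fun s => s * h s)) (hm0 : 0 < ∫ s, s * h s)
    (hf : Force f) (hfneg : ∀ t < 0, f t = 0) (hz : LB z)
    (hren : ∀ t, z t = f t + ∫ s, h s * z (t - s)) :
    (∃ B, ∀ t, z t ≤ B) ∧ Tendsto z atTop (nhds ((∫ t, f t) / ∫ s, s * h s)) := by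
  obtain ⟨B, hB⟩ := z_bdd hh h1 hK hf hz hren
  refine ⟨⟨B, hB⟩, ?_⟩
  have hB0 : 0 ≤ B := (hz.nn 0).trans (hB 0)
  have hsh := shift_lim hh h1 hf hz hB hren
  have huc := unif_conv hh hz hB
  set w : ℝ → ℝ := fun t => ∫ v, h v * z (t - v) with hw
  have hw0 : ∀ t, 0 ≤ w t := fun t => integral_nonneg fun v => mul_nonneg (hh.nn _) (hz.nn _)
  have hren' : ∀ t, z t = f t + w t := hren
  have hwz : ∀ t, w t ≤ z t := fun t => by rw [hren' t]; linarith [hf.nn t]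
  have hd : ∀ t u, |z u - w t| ≤ B := fun t u => by
    rw [abs_le]; constructor <;> linarith [hB u, hB t, hwz t, hw0 t, hz.nn u]
  have hzs : ∀ s, Tendsto (fun t => z (t - s) - w t) atTop (nhds 0) := by
    intro s
    have a1 := hf.lim.comp (tendsto_atTop_add_const_right atTop (-s) tendsto_id)
    have a2 := a1.add (hsh (-s))
    rw [add_zero] at a2
    refine a2.congr fun t => ?_
    rw [hren' (t - s)]
    simp only [Function.comp, id, hw, sub_eq_add_neg]
    ring
  have hin : ∀ s, Tendsto (fun t => ∫ v in (0:ℝ)..s, (z (t - v) - w t)) atTop (nhds 0) := by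
    intro s
    have := intervalIntegral.tendsto_integral_filter_of_dominated_convergence (μ := volume) (a := 0) (b := s)
      (F := fun t v => z (t - v) - w t) (f := fun _ => 0) (l := atTop) (fun _ => B)
      (Eventually.of_forall fun t => ((hz.meas.comp (measurable_const.sub measurable_id)).sub measurable_const).aestronglyMeasurable)
      (Eventually.of_forall fun t => Eventually.of_forall fun v _ => hd t _)
      (by simp) (Eventually.of_forall fun v _ => hzs v)
    simpa using this
  have hi2 : ∀ t s, ∫ v in (0:ℝ)..s, (z (t - v) - w t) = (∫ u in (t - s)..t, z u) - s * w t := by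
    intro t s
    have e : IntervalIntegrable (fun v => z (t - v)) volume 0 s := by
      have := (hz.ii (t - 0) (t - s)).comp_sub_left t
      simpa using this
    rw [intervalIntegral.integral_sub e (by simp), intervalIntegral.integral_comp_sub_left]
    simp
  have hout : Tendsto (fun t => ∫ s, h s * ∫ v in (0:ℝ)..s, (z (t - v) - w t)) atTop (nhds 0) := by
    have := tendsto_integral_filter_of_dominated_convergence (μ := volume)
      (F := fun t s => h s * ∫ v in (0:ℝ)..s, (z (t - v) - w t)) (f := fun _ => 0) (l := atTop)
      (fun s => B * (s * h s)) ?_ ?_ (hm.const_mul B) ?_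
    · simpa using this
    · filter_upwards [eventually_ge_atTop 0] with t ht
      simp only [hi2, mul_sub]
      refine ((hz.conv_id hh h1 ht).1.sub ((hm.mul_const (w t)).congr ?_)).aestronglyMeasurable
      exact Eventually.of_forall fun s => by ring
    · refine Eventually.of_forall fun t => Eventually.of_forall fun s => ?_
      rcases le_or_gt s 0 with hs | hs
      · simp [hh.neg s hs]
      have := intervalIntegral.norm_integral_le_of_norm_le_const (a := 0) (b := s) (C := B)
        (f := fun v => z (t - v) - w t) (fun v _ => hd t _)
      rw [sub_zero, abs_of_pos hs] at this
      rw [norm_mul, Real.norm_eq_abs, abs_of_nonneg (hh.nn s)]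
      calc _ ≤ h s * (B * s) := mul_le_mul_of_nonneg_left this (hh.nn s)
        _ = _ := by ring
    · refine Eventually.of_forall fun s => ?_
      simpa using (hin s).const_mul (h s)
  have hmass : ∀ᶠ t in atTop, ∫ s, h s * ∫ v in (0:ℝ)..s, (z (t - v) - w t) =
      (∫ u in (0:ℝ)..t, f u) - (∫ s, s * h s) * w t := by
    filter_upwards [eventually_ge_atTop 0] with t ht
    rw [mass_id hh h1 hf hz hren ht, ← integral_mul_const, ← integral_sub (hz.conv_id hh h1 ht).1 (hm.mul_const _)]
    congr 1; ext s
    rw [hi2]; ring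
  have hF : Tendsto (fun t => ∫ u in (0:ℝ)..t, f u) atTop (nhds (∫ t, f t)) := by
    have := intervalIntegral_tendsto_integral_Ioi 0 hf.int.integrableOn tendsto_id
    have e : ∫ t in Ioi 0, f t = ∫ t, f t := by
      rw [← integral_Ici_eq_integral_Ioi]
      exact setIntegral_eq_integral_of_forall_compl_eq_zero fun s hs => hfneg s (not_le.1 hs)
    rwa [e] at this
  have h5 := (hF.sub (hout.congr' hmass)).div_const (∫ s, s * h s)
  have h6 : Tendsto w atTop (nhds ((∫ t, f t) / ∫ s, s * h s)) := by
    rw [sub_zero] at h5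
    refine h5.congr fun t => ?_
    field_simp
    ring
  have h7 := hf.lim.add h6
  rw [zero_add] at h7
  exact h7.congr fun t => (hren' t).symm

lemma G_meas (α : ℝ) (ν : MeasureTheory.SignedMeasure ℝ) {ψ : ℝ → ℝ} (hψ : Measurable ψ) :
    Measurable (Gν α ν ψ) := by
  have h : StronglyMeasurable (Function.uncurry fun t u : ℝ => ψ (t + u)) :=
    (hψ.comp (measurable_fst.add measurable_snd)).stronglyMeasurable
  exact (h.integral_prod_right.sub h.integral_prod_right).measurable

lemma G_bdd (α : ℝ) (ν : MeasureTheory.SignedMeasure ℝ) {ψ : ℝ → ℝ} {K : ℝ}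
    (hK : ∀ t, -α ≤ t → |ψ t| ≤ K) : ∃ D, 0 ≤ D ∧ ∀ t, 0 ≤ t → (Gν α ν ψ t) ^ 2 ≤ D := by
  set a := K * ν.toJordanDecomposition.posPart.real (Icc (-α) 0)
  set b := K * ν.toJordanDecomposition.negPart.real (Icc (-α) 0)
  refine ⟨(a + b) ^ 2, sq_nonneg _, fun t ht => ?_⟩
  have h1 : ‖∫ u in Set.Icc (-α) 0, ψ (t + u) ∂ν.toJordanDecomposition.posPart‖ ≤ a :=
    norm_setIntegral_le_of_norm_le_const (measure_lt_top _ _) fun u hu => hK _ (by linarith [hu.1])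
  have h2 : ‖∫ u in Set.Icc (-α) 0, ψ (t + u) ∂ν.toJordanDecomposition.negPart‖ ≤ b :=
    norm_setIntegral_le_of_norm_le_const (measure_lt_top _ _) fun u hu => hK _ (by linarith [hu.1])
  refine sq_le_sq' ?_ ?_ <;> unfold Gν <;> rw [Real.norm_eq_abs, abs_le] at h1 h2 <;> linarith [h1.1, h1.2, h2.1, h2.2]

lemma exists_kappa {p : ℝ → ℝ} (hp : Dens p) {D : ℝ} (hD : ∀ s, p s ≤ D) (h1 : 1 < ∫ s, p s) :
    ∃ κ : ℝ, (0 < κ ∧ ∫ s, Real.exp (-κ * s) * p s = 1) ∧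
      ∀ κ' : ℝ, 0 < κ' → ∫ s, Real.exp (-κ' * s) * p s = 1 → κ' = κ := by
  have hle : ∀ κ, 0 ≤ κ → ∀ s, Real.exp (-κ * s) * p s ≤ p s := by
    intro κ hκ s
    rcases le_or_gt s 0 with hs | hs
    · simp [hp.neg s hs]
    · exact mul_le_of_le_one_left (hp.nn s) (Real.exp_le_one_iff.2 (by nlinarith))
  have hnn : ∀ κ s, 0 ≤ Real.exp (-κ * s) * p s := fun κ s => mul_nonneg (Real.exp_pos _).le (hp.nn s)
  have hmeas : ∀ κ, Measurable (fun s => Real.exp (-κ * s) * p s) := fun κ =>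
    (Real.measurable_exp.comp (measurable_const.mul measurable_id)).mul hp.meas
  have hintg : ∀ κ, 0 ≤ κ → Integrable (fun s => Real.exp (-κ * s) * p s) := fun κ hκ =>
    hp.int.mono' (hmeas κ).aestronglyMeasurable (Eventually.of_forall fun s => by
      rw [Real.norm_eq_abs, abs_of_nonneg (hnn κ s)]; exact hle κ hκ s)
  have hcont : Continuous (fun κ : ℝ => ∫ s, Real.exp (-|κ| * s) * p s) := by
    refine continuous_of_dominated (fun κ => (hmeas _).aestronglyMeasurable) (bound := p) ?_ hp.int ?_
    · intro κ
      refine Eventually.of_forall fun s => ?_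
      rw [Real.norm_eq_abs, abs_of_nonneg (hnn _ s)]; exact hle _ (abs_nonneg κ) s
    · exact Eventually.of_forall fun s => by fun_prop
  have hD0 : 0 ≤ D := (hp.nn 0).trans (hD 0)
  have hsm : ∫ s, Real.exp (-|D + 1| * s) * p s ≤ 1 := by
    rw [abs_of_pos (by positivity)]
    have e : ∫ s in Ioi 0, Real.exp (-(D + 1) * s) * p s = ∫ s, Real.exp (-(D + 1) * s) * p s :=
      setIntegral_eq_integral_of_forall_compl_eq_zero fun s hs => by rw [hp.neg s (not_lt.1 hs), mul_zero]
    rw [← e]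
    have hi : IntegrableOn (fun s => Real.exp (-(D + 1) * s)) (Ioi 0) :=
      exp_neg_integrableOn_Ioi 0 (by positivity)
    have : ∫ s in Ioi 0, Real.exp (-(D + 1) * s) * p s ≤ ∫ s in Ioi 0, Real.exp (-(D + 1) * s) * D :=
      integral_mono (hintg _ (by positivity)).integrableOn (hi.mul_const D)
        fun s => mul_le_mul_of_nonneg_left (hD s) (Real.exp_pos _).le
    refine this.trans ?_
    rw [integral_mul_const, integral_exp_mul_Ioi (by linarith)]
    simp
    rw [← neg_add, neg_div_neg_eq, one_div, inv_mul_le_iff₀ (by positivity)]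
    linarith
  obtain ⟨κ, hκ, he⟩ := intermediate_value_Icc' (show (0:ℝ) ≤ D + 1 by positivity) hcont.continuousOn
    (show (1:ℝ) ∈ Icc _ _ from ⟨hsm, by simpa using h1.le⟩)
  beta_reduce at he
  rw [abs_of_nonneg hκ.1] at he
  have hκ0 : 0 < κ := by
    rcases hκ.1.lt_or_eq with h | h
    · exact h
    · rw [← h] at he; simp at he; linarith
  have uniq : ∀ a b : ℝ, 0 < a → a < b → ∫ s, Real.exp (-a * s) * p s = 1 →
      ∫ s, Real.exp (-b * s) * p s = 1 → False := by
    intro a b ha hab h2 h3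
    have hd : ∀ s, 0 ≤ Real.exp (-a * s) * p s - Real.exp (-b * s) * p s := by
      intro s
      rw [sub_nonneg]
      rcases le_or_gt s 0 with hs | hs
      · simp [hp.neg s hs]
      · exact mul_le_mul_of_nonneg_right (Real.exp_le_exp.2 (by nlinarith)) (hp.nn s)
    have h4 : ∫ s, (Real.exp (-a * s) * p s - Real.exp (-b * s) * p s) = 0 := by
      rw [integral_sub (hintg a ha.le) (hintg b (ha.trans hab).le), h2, h3, sub_self]
    rw [integral_eq_zero_iff_of_nonneg hd ((hintg a ha.le).sub (hintg b (ha.trans hab).le))] at h4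
    have h5 : p =ᵐ[volume] 0 := by
      filter_upwards [h4] with s hs
      rcases le_or_gt s 0 with hs0 | hs0
      · exact hp.neg s hs0
      simp only [Pi.zero_apply, ← sub_mul, mul_eq_zero] at hs ⊢
      refine hs.resolve_left (sub_pos.2 (Real.exp_lt_exp.2 (by nlinarith))).ne'
    rw [integral_congr_ae h5] at h1
    simp at h1
    linarith
  refine ⟨κ, ⟨hκ0, he⟩, fun κ' h' he' => ?_⟩
  rcases lt_trichotomy κ' κ with h | h | h
  · exact (uniq _ _ h' h he' he).elim
  · exact h
  · exact (uniq _ _ hκ0 h he he').elim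

lemma mean_pos {h : ℝ → ℝ} (hh : Dens h) (h1 : ∫ s, h s = 1) (hm : Integrable (fun s => s * h s)) :
    0 < ∫ s, s * h s := by
  have nn : ∀ s, 0 ≤ s * h s := by
    intro s
    rcases le_or_gt s 0 with hs | hs
    · simp [hh.neg s hs]
    · exact mul_nonneg hs.le (hh.nn s)
  refine lt_of_le_of_ne (integral_nonneg nn) fun h0 => ?_
  have h2 := (integral_eq_zero_iff_of_nonneg nn hm).1 h0.symm
  have h5 : h =ᵐ[volume] 0 := by
    filter_upwards [h2] with s hs
    rcases le_or_gt s 0 with hs0 | hs0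
    · exact hh.neg s hs0
    · exact (mul_eq_zero.1 hs).resolve_left hs0.ne'
  rw [integral_congr_ae h5] at h1
  simp at h1

lemma conv_red (κ : ℝ) (q0 y : ℝ → ℝ) {t : ℝ} (ht : 0 ≤ t) :
    ∫ s, (Ioi (0:ℝ)).indicator (fun s => Real.exp (-κ * s) * q0 s) s *
      (Ici (0:ℝ)).indicator (fun s => Real.exp (-κ * s) * y s) (t - s) =
    Real.exp (-κ * t) * ∫ s in (0:ℝ)..t, q0 (t - s) * y s := by
  have e := intervalIntegral.integral_comp_sub_left (a := 0) (b := t) (fun v => q0 v * y (t - v)) t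
  simp only [sub_sub_cancel, sub_self, sub_zero] at e
  rw [e, intervalIntegral.integral_of_le ht, ← integral_const_mul, ← integral_indicator measurableSet_Ioc]
  congr 1; ext s
  simp only [indicator, mem_Ioi, mem_Ici, mem_Ioc, sub_nonneg]
  by_cases h1 : 0 < s <;> by_cases h2 : s ≤ t <;> simp only [h1, h2, and_self, if_true, if_false, and_true, and_false, true_and, false_and, mul_zero, zero_mul]
  rw [show -κ * t = -κ * s + -κ * (t - s) by ring, Real.exp_add]
  ring

/-- Deterministic core of Theorem 3.2(c): excessive case. -/
theorem stmt2 (α : ℝ) (hα : 0 ≤ α) (ν : MeasureTheory.SignedMeasure ℝ)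
    (C γ : ℝ) (hC : 0 < C) (hγ : 0 < γ)
    (r : ℝ → ℝ) (hrmeas : Measurable r) (hrneg : ∀ u < (0:ℝ), r u = 0)
    (hrdecay : ∀ t ≥ (0:ℝ), |r t| ≤ C * Real.exp (-γ * t))
    (x : ℝ → ℝ) (hxcont : Continuous x)
    (hxdecay : ∀ t ≥ (0:ℝ), |x t| ≤ C * Real.exp (-γ * t))
    (f g : ℝ → ℝ)
    (hf : ∀ t ≥ (0:ℝ), f t = (Gν α ν x t) ^ 2)
    (hg : ∀ t ≥ (0:ℝ), g t = (Gν α ν r t) ^ 2)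
    (y : ℝ → ℝ) (hymeas : Measurable y) (hynn : ∀ t ≥ (0:ℝ), 0 ≤ y t)
    (hybdd : ∀ T : ℝ, ∃ K : ℝ, ∀ t ∈ Set.Icc (0:ℝ) T, y t ≤ K)
    (hren : ∀ t ≥ (0:ℝ), y t = f t + ∫ s in (0:ℝ)..t, g (t - s) * y s)
    (M : ℝ → ℝ)
    (hM : ∀ t ≥ (0:ℝ), M t = (x t) ^ 2 + ∫ s in (0:ℝ)..t, (r (t - s)) ^ 2 * y s)
    (hexcessive : 1 < (∫ s in Set.Ioi (0:ℝ), g s)) :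
    ∃ κ : ℝ, (0 < κ ∧ (∫ s in Set.Ioi (0:ℝ), Real.exp (-κ * s) * g s) = 1) ∧
      (∀ κ' : ℝ, 0 < κ' → (∫ s in Set.Ioi (0:ℝ), Real.exp (-κ' * s) * g s) = 1 → κ' = κ) ∧
      MeasureTheory.IntegrableOn (fun s => s * (Real.exp (-κ * s) * g s)) (Set.Ioi 0) ∧
      0 < (∫ s in Set.Ioi (0:ℝ), s * (Real.exp (-κ * s) * g s)) ∧
      Tendsto (fun t => Real.exp (-κ * t) * M t) atTop (nhds
        ((∫ s in Set.Ioi (0:ℝ), Real.exp (-κ * s) * f s)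
          * (∫ s in Set.Ioi (0:ℝ), Real.exp (-κ * s) * (r s) ^ 2)
          / (∫ s in Set.Ioi (0:ℝ), s * (Real.exp (-κ * s) * g s)))) := by
  -- the kernel
  set p : ℝ → ℝ := (Ioi (0:ℝ)).indicator (fun s => (Gν α ν r s) ^ 2) with hp
  have hpg : ∀ s ∈ Ioi (0:ℝ), p s = g s := fun s hs => by
    rw [hp, indicator_of_mem hs, hg s (le_of_lt hs)]
  have hpint : ∀ k : ℝ → ℝ, ∫ s in Ioi (0:ℝ), k s * g s = ∫ s, k s * p s := by
    intro k
    rw [← setIntegral_eq_integral_of_forall_compl_eq_zero (s := Ioi (0:ℝ)) (f := fun s => k s * p s)]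
    · exact setIntegral_congr_fun measurableSet_Ioi fun s hs => by beta_reduce; rw [hpg s hs]
    · intro s hs
      rw [hp, indicator_of_notMem hs, mul_zero]
  have hp1 : 1 < ∫ s, p s := by
    have := hpint (fun _ => 1)
    simp only [one_mul] at this
    rwa [← this]
  have hpi : Integrable p := by
    by_contra hc
    rw [integral_undef hc] at hp1
    linarith
  have hrK : ∀ t, |r t| ≤ C := by
    intro t
    rcases lt_or_ge t 0 with h | h
    · rw [hrneg t h]; simpa using hC.le
    · refine (hrdecay t h).trans (mul_le_of_le_one_right hC.le (Real.exp_le_one_iff.2 (by nlinarith)))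
  obtain ⟨D, hD0, hD⟩ := G_bdd α ν (ψ := r) (fun t _ => hrK t)
  have hpd : Dens p :=
    { meas := ((G_meas α ν hrmeas).pow_const 2).indicator measurableSet_Ioi
      nn := fun t => indicator_nonneg (fun s _ => sq_nonneg _) t
      neg := fun t ht => indicator_of_notMem (by simpa using ht) _
      int := hpi }
  have hpD : ∀ s, p s ≤ D := fun s => by
    refine indicator_le' (fun s hs => hD s (le_of_lt hs)) (fun s _ => hD0) s
  obtain ⟨κ, ⟨hκ, hκ1⟩, huniq⟩ := exists_kappa hpd hpD hp1
  -- tilted kernel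
  set h : ℝ → ℝ := (Ioi (0:ℝ)).indicator (fun s => Real.exp (-κ * s) * g s) with hh
  have hhp : ∀ s, h s = Real.exp (-κ * s) * p s := by
    intro s
    by_cases hs : s ∈ Ioi (0:ℝ)
    · rw [hh, indicator_of_mem hs, hpg s hs]
    · rw [hh, hp, indicator_of_notMem hs, indicator_of_notMem hs, mul_zero]
  have hexpm : Measurable (fun s : ℝ => Real.exp (-κ * s)) :=
    Real.measurable_exp.comp (measurable_const.mul measurable_id)
  have hhm : Measurable h := by
    rw [show h = fun s => Real.exp (-κ * s) * p s from funext hhp]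
    exact hexpm.mul hpd.meas
  have hh0 : ∀ s, 0 ≤ h s := fun s => by rw [hhp]; exact mul_nonneg (Real.exp_pos _).le (hpd.nn s)
  have hexp1 : ∀ s : ℝ, 0 ≤ s → Real.exp (-κ * s) ≤ 1 := fun s hs => Real.exp_le_one_iff.2 (by nlinarith)
  have hhle : ∀ s, h s ≤ p s := fun s => by
    rw [hhp]
    rcases le_or_gt s 0 with hs | hs
    · simp [hpd.neg s hs]
    · exact mul_le_of_le_one_left (hpd.nn s) (hexp1 s hs.le)
  have hhd : Dens h :=
    { meas := hhm
      nn := hh0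
      neg := fun t ht => by rw [hhp, hpd.neg t ht, mul_zero]
      int := hpi.mono' hhm.aestronglyMeasurable (Eventually.of_forall fun s => by
        rw [Real.norm_eq_abs, abs_of_nonneg (hh0 s)]; exact hhle s) }
  have hh1 : ∫ s, h s = 1 := by simp only [hhp]; exact hκ1
  have hmi : Integrable (fun s => s * h s) := by
    refine (hpi.const_mul κ⁻¹).mono' (measurable_id.mul hhm).aestronglyMeasurable (Eventually.of_forall fun s => ?_)
    rcases le_or_gt s 0 with hs | hs
    · simp [hhd.neg s hs, hpd.neg s hs]
    · rw [Real.norm_eq_abs, abs_of_nonneg (mul_nonneg hs.le (hh0 s)), hhp, ← mul_assoc]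
      refine mul_le_mul_of_nonneg_right ?_ (hpd.nn s)
      have e1 := Real.add_one_le_exp (κ * s)
      rw [neg_mul, Real.exp_neg, ← div_eq_mul_inv, div_le_iff₀ (Real.exp_pos _), inv_mul_eq_div,
        le_div_iff₀ hκ]
      linarith
  have hmp := mean_pos hhd hh1 hmi
  have hmeq : ∫ s in Ioi (0:ℝ), s * (Real.exp (-κ * s) * g s) = ∫ s, s * h s := by
    have := hpint (fun s => s * Real.exp (-κ * s))
    simp only [mul_assoc] at this
    rw [this]
    simp only [hhp]
  -- forcing term
  obtain ⟨Kx, hKx⟩ := (isCompact_Icc (a := -α) (b := 0)).exists_bound_of_continuousOn hxcont.continuousOn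
  have hxK0 : ∀ t, 0 ≤ t → |x t| ≤ C := fun t ht =>
    (hxdecay t ht).trans (mul_le_of_le_one_right hC.le (Real.exp_le_one_iff.2 (by nlinarith)))
  have hxK : ∀ t, -α ≤ t → |x t| ≤ max C Kx := by
    intro t ht
    rcases lt_or_ge t 0 with h | h
    · exact (hKx t ⟨ht, h.le⟩).trans (le_max_right _ _)
    · exact (hxK0 t h).trans (le_max_left _ _)
  obtain ⟨E, hE0, hE⟩ := G_bdd α ν hxK
  have hexpint : IntegrableOn (fun s : ℝ => Real.exp (-κ * s)) (Ici 0) :=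
    (integrableOn_Ici_iff_integrableOn_Ioi).2 (exp_neg_integrableOn_Ioi 0 hκ)
  have hexplim : Tendsto (fun t : ℝ => Real.exp (-κ * t)) atTop (nhds 0) :=
    Real.tendsto_exp_atBot.comp (tendsto_id.const_mul_atTop_of_neg (by linarith))
  set F : ℝ → ℝ := (Ici (0:ℝ)).indicator (fun s => Real.exp (-κ * s) * (Gν α ν x s) ^ 2) with hF
  have hFm : Measurable F :=
    (hexpm.mul ((G_meas α ν hxcont.measurable).pow_const 2)).indicator measurableSet_Ici
  have hF0 : ∀ t, 0 ≤ F t := fun t =>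
    indicator_nonneg (fun s _ => mul_nonneg (Real.exp_pos _).le (sq_nonneg _)) t
  have hFle : ∀ t, F t ≤ (Ici (0:ℝ)).indicator (fun s => Real.exp (-κ * s)) t * E := by
    intro t
    by_cases ht : t ∈ Ici (0:ℝ)
    · rw [hF, indicator_of_mem ht, indicator_of_mem ht]
      exact mul_le_mul_of_nonneg_left (hE t ht) (Real.exp_pos _).le
    · rw [hF, indicator_of_notMem ht, indicator_of_notMem ht, zero_mul]
  have hFf : Force F :=
    { meas := hFm
      nn := hF0
      bdd := ⟨E, fun t => (hFle t).trans (mul_le_of_le_one_left hE0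
        (indicator_le' (fun s hs => hexp1 s hs) (fun s _ => zero_le_one) t))⟩
      int := ((hexpint.integrable_indicator measurableSet_Ici).mul_const E).mono' hFm.aestronglyMeasurable
        (Eventually.of_forall fun t => by rw [Real.norm_eq_abs, abs_of_nonneg (hF0 t)]; exact hFle t)
      lim := by
        have hlim := hexplim.mul_const E
        rw [zero_mul] at hlim
        refine tendsto_of_tendsto_of_tendsto_of_le_of_le' tendsto_const_nhds hlim
          (Eventually.of_forall hF0) ?_
        filter_upwards [eventually_ge_atTop 0] with t ht
        have := hFle t
        rwa [indicator_of_mem (show t ∈ Ici (0:ℝ) from ht)] at this }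
  have hFeq : ∫ s in Ioi (0:ℝ), Real.exp (-κ * s) * f s = ∫ t, F t := by
    rw [hF, integral_indicator measurableSet_Ici, integral_Ici_eq_integral_Ioi]
    exact setIntegral_congr_fun measurableSet_Ioi fun s hs => by
      beta_reduce; rw [hf s (le_of_lt hs)]
  -- tilted solution
  set z : ℝ → ℝ := (Ici (0:ℝ)).indicator (fun s => Real.exp (-κ * s) * y s) with hz
  have hzlb : LB z :=
    { meas := (hexpm.mul hymeas).indicator measurableSet_Ici
      nn := fun t => indicator_nonneg (fun s hs => mul_nonneg (Real.exp_pos _).le (hynn s hs)) t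
      neg := fun t ht => indicator_of_notMem (by simpa using ht) _
      bdd := fun T => by
        obtain ⟨K, hK⟩ := hybdd T
        refine ⟨max K 0, fun t ht => ?_⟩
        by_cases h0 : t ∈ Ici (0:ℝ)
        · rw [hz, indicator_of_mem h0]
          exact (mul_le_of_le_one_left (hynn t h0) (hexp1 t h0)).trans ((hK t ⟨h0, ht⟩).trans (le_max_left _ _))
        · rw [hz, indicator_of_notMem h0]
          exact le_max_right _ _ }
  have hzren : ∀ t, z t = F t + ∫ s, h s * z (t - s) := by
    intro t
    rcases lt_or_ge t 0 with ht | ht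
    · have e : ∀ s, h s * z (t - s) = 0 := by
        intro s
        rcases le_or_gt s 0 with hs | hs
        · rw [hhd.neg s hs, zero_mul]
        · rw [hzlb.neg _ (by linarith), mul_zero]
      simp only [e, integral_zero, add_zero]
      rw [hzlb.neg t ht, hF, indicator_of_notMem (by simpa using ht)]
    · rw [hh, hz, conv_red κ g y ht, hF, indicator_of_mem (show t ∈ Ici (0:ℝ) from ht),
        indicator_of_mem (show t ∈ Ici (0:ℝ) from ht), hren t ht, hf t ht, mul_add]
  obtain ⟨⟨B, hB⟩, hzlim⟩ := renewal hhd hh1 ⟨D, fun s => (hhle s).trans (hpD s)⟩ hmi hmp hFf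
    (fun t ht => indicator_of_notMem (by simpa using ht) _) hzlb hzren
  refine ⟨κ, ⟨hκ, by rw [hpint]; exact hκ1⟩, ?_, ?_, ?_, ?_⟩
  · intro κ' h1 h2
    rw [hpint] at h2
    exact huniq κ' h1 h2
  · refine hmi.integrableOn.congr_fun (fun s hs => ?_) measurableSet_Ioi
    beta_reduce
    rw [hh, indicator_of_mem hs]
  · rw [hmeq]; exact hmp
  · rw [hmeq, hFeq]
    set q : ℝ → ℝ := (Ioi (0:ℝ)).indicator (fun s => Real.exp (-κ * s) * (r s) ^ 2) with hq
    have hqm : Measurable q := (hexpm.mul (hrmeas.pow_const 2)).indicator measurableSet_Ioi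
    have hq0 : ∀ t, 0 ≤ q t := fun t =>
      indicator_nonneg (fun s _ => mul_nonneg (Real.exp_pos _).le (sq_nonneg _)) t
    have hqi : Integrable q := by
      have h0 : Integrable ((Ioi (0:ℝ)).indicator (fun s : ℝ => Real.exp (-κ * s))) :=
        IntegrableOn.integrable_indicator (exp_neg_integrableOn_Ioi 0 hκ) measurableSet_Ioi
      refine (h0.mul_const (C ^ 2)).mono' hqm.aestronglyMeasurable (Eventually.of_forall fun s => ?_)
      rw [Real.norm_eq_abs, abs_of_nonneg (hq0 s)]
      by_cases hs : s ∈ Ioi (0:ℝ)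
      · rw [hq, indicator_of_mem hs, indicator_of_mem hs]
        refine mul_le_mul_of_nonneg_left ?_ (Real.exp_pos _).le
        exact sq_le_sq' (abs_le.1 (hrK s)).1 (abs_le.1 (hrK s)).2
      · rw [hq, indicator_of_notMem hs, indicator_of_notMem hs, zero_mul]
    have hqeq : ∫ s in Ioi (0:ℝ), Real.exp (-κ * s) * (r s) ^ 2 = ∫ s, q s := by
      rw [hq, integral_indicator measurableSet_Ioi]
    rw [hqeq]
    have hconv : Tendsto (fun t => ∫ s, q s * z (t - s)) atTop
        (nhds (∫ s, q s * ((∫ t, F t) / ∫ s, s * h s))) := by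
      refine tendsto_integral_filter_of_dominated_convergence (fun s => q s * B) ?_ ?_ (hqi.mul_const B) ?_
      · exact Eventually.of_forall fun t =>
          (hqm.mul (hzlb.meas.comp (measurable_const.sub measurable_id))).aestronglyMeasurable
      · refine Eventually.of_forall fun t => Eventually.of_forall fun s => ?_
        rw [Real.norm_eq_abs, abs_of_nonneg (mul_nonneg (hq0 s) (hzlb.nn _))]
        exact mul_le_mul_of_nonneg_left (hB _) (hq0 s)
      · refine Eventually.of_forall fun s => ?_
        exact (hzlim.comp (tendsto_atTop_add_const_right atTop (-s) tendsto_id)).const_mul (q s)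
    have hxl : Tendsto (fun t => Real.exp (-κ * t) * (x t) ^ 2) atTop (nhds 0) := by
      have hlim := hexplim.mul_const (C ^ 2)
      rw [zero_mul] at hlim
      refine tendsto_of_tendsto_of_tendsto_of_le_of_le' tendsto_const_nhds hlim
        (Eventually.of_forall fun t => mul_nonneg (Real.exp_pos _).le (sq_nonneg _)) ?_
      filter_upwards [eventually_ge_atTop 0] with t ht
      refine mul_le_mul_of_nonneg_left ?_ (Real.exp_pos _).le
      exact sq_le_sq' (abs_le.1 (hxK0 t ht)).1 (abs_le.1 (hxK0 t ht)).2
    have hfin := hxl.add hconv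
    rw [zero_add, integral_mul_const] at hfin
    rw [show (∫ t, F t) * (∫ s, q s) / (∫ s, s * h s) = (∫ s, q s) * ((∫ t, F t) / ∫ s, s * h s) by ring]
    refine hfin.congr' ?_
    filter_upwards [eventually_ge_atTop 0] with t ht
    rw [hM t ht, mul_add, hq, hz, conv_red κ (fun s => (r s) ^ 2) y ht]
end

section
/- (Intermediate step in the proof of Theorem 3.2(c).) If ∫₀^∞ g(s) ds > 1 and κ > 0 satisfies ∫₀^∞ e^{−κs} g(s) ds = 1, then 0 < ∫₀^∞ s·e^{−κs} g(s) ds < ∞ and e^{−κt}·y(t) → (∫₀^∞ e^{−κs} f(s) ds) / (∫₀^∞ s·e^{−κs} g(s) ds) as t → ∞. -/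
open MeasureTheory Filter Set

lemma fub_int (k w : ℝ → ℝ) (hki : Integrable k) (hk0 : ∀ s < 0, k s = 0)
    (hw : Measurable w) (hwb : ∀ T : ℝ, ∃ K : ℝ, ∀ t ≤ T, |w t| ≤ K) (T : ℝ) :
    Integrable (fun p : ℝ × ℝ => k p.2 * w (p.1 - p.2))
      ((volume.restrict (Ioc 0 T)).prod volume) := by
  obtain ⟨K, hK⟩ := hwb T
  have hK0 : 0 ≤ K := (abs_nonneg _).trans (hK T le_rfl)
  have h1 : Integrable (fun p : ℝ × ℝ => K * k p.2) ((volume.restrict (Ioc 0 T)).prod volume) :=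
    (hki.comp_snd _).const_mul K
  refine h1.mono ?_ ?_
  · refine ((hki.comp_snd (volume.restrict (Ioc 0 T))).aestronglyMeasurable).mul ?_
    exact (hw.comp (measurable_fst.sub measurable_snd)).aestronglyMeasurable
  · have : ∀ᵐ p ∂((volume.restrict (Ioc 0 T)).prod (volume : Measure ℝ)), p.1 ≤ T := by
      have h2 : ∀ᵐ t ∂(volume.restrict (Ioc (0:ℝ) T)), t ≤ T := by
        filter_upwards [ae_restrict_mem measurableSet_Ioc] with t ht using ht.2
      exact Measure.quasiMeasurePreserving_fst.ae h2
    filter_upwards [this] with p hp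
    rcases lt_or_ge p.2 0 with h | h
    · simp [hk0 _ h]
    · rw [norm_mul, norm_mul, mul_comm]
      have := hK (p.1 - p.2) (by linarith)
      gcongr
      rw [Real.norm_eq_abs, Real.norm_eq_abs, abs_of_nonneg hK0]; exact this

lemma loc_int (w : ℝ → ℝ) (hw : Measurable w)
    (hwb : ∀ T : ℝ, ∃ K : ℝ, ∀ t ≤ T, |w t| ≤ K) (a b : ℝ) :
    IntervalIntegrable w volume a b := by
  obtain ⟨K, hK⟩ := hwb (max a b)
  refine (intervalIntegrable_const (c := K)).mono_fun hw.aestronglyMeasurable ?_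
  filter_upwards [ae_restrict_mem measurableSet_uIoc] with t ht
  have := hK t ht.2
  rw [Real.norm_eq_abs, Real.norm_eq_abs]
  exact this.trans (le_abs_self _)

lemma fub (k w : ℝ → ℝ) (hki : Integrable k) (hk0 : ∀ s < 0, k s = 0) (hk1 : ∫ s, k s = 1)
    (hw : Measurable w) (hw0 : ∀ s < 0, w s = 0)
    (hwb : ∀ T : ℝ, ∃ K : ℝ, ∀ t ≤ T, |w t| ≤ K) (T : ℝ) (hT : 0 ≤ T) :
    Integrable (fun s => k s * ∫ t in (T - s)..T, w t) ∧
    IntervalIntegrable (fun t => ∫ s, k s * w (t - s)) volume 0 T ∧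
    (∫ t in (0:ℝ)..T, (w t - ∫ s, k s * w (t - s))) = ∫ s, k s * ∫ t in (T - s)..T, w t := by
  have hI := fub_int k w hki hk0 hw hwb T
  have hL := loc_int w hw hwb
  have hsw : (∫ t in (0:ℝ)..T, ∫ s, k s * w (t - s)) =
      ∫ s, k s * ∫ t in (0:ℝ)..T, w (t - s) := by
    rw [intervalIntegral.integral_of_le hT, integral_integral_swap hI]
    congr 1; ext s
    rw [intervalIntegral.integral_of_le hT, integral_const_mul]
  have hI1 : IntervalIntegrable (fun t => ∫ s, k s * w (t - s)) volume 0 T := by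
    rw [intervalIntegrable_iff_integrableOn_Ioc_of_le hT]
    exact hI.integral_prod_left
  have hI2 : Integrable (fun s => k s * ∫ t in (0:ℝ)..T, w (t - s)) := by
    have := hI.integral_prod_right
    refine this.congr (Eventually.of_forall fun s => ?_)
    simp only
    rw [intervalIntegral.integral_of_le hT, integral_const_mul]
  have key : ∀ s, k s * (∫ t in (T - s)..T, w t) =
      k s * (∫ t in (0:ℝ)..T, w t) - k s * ∫ t in (0:ℝ)..T, w (t - s) := by
    intro s
    rcases lt_or_ge s 0 with h | h
    · simp [hk0 s h]
    rw [← mul_sub, intervalIntegral.integral_comp_sub_right]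
    congr 1
    have e0 : (∫ t in (0 - s)..0, w t) = 0 := by
      rw [intervalIntegral.integral_of_le (by linarith), integral_Ioc_eq_integral_Ioo]
      exact setIntegral_eq_zero_of_forall_eq_zero fun t ht => hw0 t ht.2
    have e1 := intervalIntegral.integral_add_adjacent_intervals (hL (0-s) 0) (hL 0 T)
    have e2 := intervalIntegral.integral_add_adjacent_intervals (hL (0-s) (T-s)) (hL (T-s) T)
    linarith
  refine ⟨?_, hI1, ?_⟩
  · simp_rw [key]
    exact (hki.mul_const _).sub hI2
  rw [intervalIntegral.integral_sub (hL _ _) hI1, hsw]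
  simp_rw [key]
  rw [integral_sub (hki.mul_const _) hI2, integral_mul_const, hk1, one_mul]

lemma conv_eq (k z : ℝ → ℝ) (hk0 : ∀ s < 0, k s = 0) (hz0 : ∀ s < 0, z s = 0) (t : ℝ)
    (ht : 0 ≤ t) : (∫ s, k s * z (t - s)) = ∫ s in (0:ℝ)..t, k (t - s) * z s := by
  have h1 : (∫ s in (0:ℝ)..t, k (t - s) * z s) = ∫ s in (0:ℝ)..t, k s * z (t - s) := by
    have := intervalIntegral.integral_comp_sub_left (a := 0) (b := t)
      (fun s => k s * z (t - s)) t
    simpa using this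
  rw [h1, intervalIntegral.integral_of_le ht, ← integral_Icc_eq_integral_Ioc,
    setIntegral_eq_integral_of_forall_compl_eq_zero]
  intro s hs
  simp only [mem_Icc, not_and_or, not_le] at hs
  rcases hs with h | h
  · simp [hk0 s h]
  · simp [hz0 (t - s) (by linarith)]

structure Ren (k h z : ℝ → ℝ) (M δ : ℝ) : Prop where
  M0 : 0 < M
  d0 : 0 < δ
  km : Measurable k
  hm : Measurable h
  zm : Measurable z
  k0 : ∀ s < 0, k s = 0
  h0 : ∀ s < 0, h s = 0
  z0 : ∀ s < 0, z s = 0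
  kn : ∀ s, 0 ≤ k s
  hn : ∀ s, 0 ≤ h s
  zn : ∀ s, 0 ≤ z s
  kb : ∀ s, 0 ≤ s → k s ≤ M * Real.exp (-δ * s)
  hb : ∀ s, 0 ≤ s → h s ≤ M * Real.exp (-δ * s)
  zb : ∀ T : ℝ, ∃ K : ℝ, ∀ t ≤ T, |z t| ≤ K
  k1 : ∫ s, k s = 1
  eq : ∀ t, 0 ≤ t → z t = h t + ∫ s, k s * z (t - s)

lemma exp_int (k : ℝ → ℝ) (M δ : ℝ) (hδ : 0 < δ) (hkm : Measurable k) (hk0 : ∀ s < 0, k s = 0)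
    (hkn : ∀ s, 0 ≤ k s) (hkb : ∀ s, 0 ≤ s → k s ≤ M * Real.exp (-δ * s)) : Integrable k := by
  have h1 : IntegrableOn k (Ici 0) := by
    have h2 : IntegrableOn (fun s => M * Real.exp (-δ * s)) (Ici 0) := by
      rw [integrableOn_Ici_iff_integrableOn_Ioi]
      exact (integrableOn_exp_mul_Ioi (by linarith) 0).const_mul M
    refine Integrable.mono' h2 hkm.aestronglyMeasurable ?_
    filter_upwards [ae_restrict_mem measurableSet_Ici] with s hs
    rw [Real.norm_eq_abs, abs_of_nonneg (hkn s)]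
    exact hkb s hs
  rw [integrableOn_iff_integrable_of_support_subset] at h1
  · exact h1
  · intro s hs
    by_contra h
    exact hs (hk0 s (by simpa using h))

lemma exp_int' (k : ℝ → ℝ) (M δ : ℝ) (hδ : 0 < δ) (hkm : Measurable k) (hk0 : ∀ s < 0, k s = 0)
    (hkn : ∀ s, 0 ≤ k s) (hkb : ∀ s, 0 ≤ s → k s ≤ M * Real.exp (-δ * s)) :
    Integrable (fun s => s * k s) := by
  refine exp_int _ (M * (2 / δ)) (δ / 2) (by linarith) (measurable_id.mul hkm) ?_ ?_ ?_
  · intro s hs; simp [hk0 s hs]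
  · intro s
    rcases lt_or_ge s 0 with h | h
    · simp [hk0 s h]
    · exact mul_nonneg h (hkn s)
  · intro s hs
    have hM : 0 ≤ M := by have := (hkn 0).trans (hkb 0 le_rfl); simpa using this
    have h1 := Real.add_one_le_exp (δ / 2 * s)
    have h2 : s ≤ 2 / δ * Real.exp (δ / 2 * s) := by
      rw [div_mul_eq_mul_div, le_div_iff₀ hδ]; linarith
    calc s * k s ≤ (2 / δ * Real.exp (δ / 2 * s)) * (M * Real.exp (-δ * s)) :=
          mul_le_mul h2 (hkb s hs) (hkn s) (by positivity)
      _ = M * (2 / δ) * (Real.exp (δ / 2 * s) * Real.exp (-δ * s)) := by ring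
      _ = _ := by rw [← Real.exp_add]; ring_nf

namespace Ren
variable {k h z : ℝ → ℝ} {M δ : ℝ}

lemma ki (R : Ren k h z M δ) : Integrable k := exp_int k M δ R.d0 R.km R.k0 R.kn R.kb
lemma hi (R : Ren k h z M δ) : Integrable h := exp_int h M δ R.d0 R.hm R.h0 R.hn R.hb
lemma kM (R : Ren k h z M δ) (s : ℝ) : k s ≤ M := by
  rcases lt_or_ge s 0 with hs | hs
  · rw [R.k0 s hs]; exact R.M0.le
  · refine (R.kb s hs).trans ?_
    have : Real.exp (-δ * s) ≤ 1 := Real.exp_le_one_iff.2 (by nlinarith [R.d0])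
    nlinarith [R.M0]

lemma zI (R : Ren k h z M δ) (a b : ℝ) : IntervalIntegrable z volume a b := loc_int z R.zm R.zb a b

lemma cons (R : Ren k h z M δ) (T : ℝ) (hT : 0 ≤ T) :
    (∫ t in (0:ℝ)..T, h t) = ∫ s, k s * ∫ t in (T - s)..T, z t := by
  rw [← (fub k z R.ki R.k0 R.k1 R.zm R.z0 R.zb T hT).2.2]
  refine intervalIntegral.integral_congr fun t ht => ?_
  rw [uIcc_of_le hT] at ht
  have := R.eq t ht.1
  linarith

lemma hle (R : Ren k h z M δ) (T : ℝ) (hT : 0 ≤ T) : (∫ t in (0:ℝ)..T, h t) ≤ ∫ t, h t := by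
  rw [intervalIntegral.integral_of_le hT]
  exact setIntegral_le_integral R.hi (Eventually.of_forall R.hn)

lemma unit_bd (R : Ren k h z M δ) : ∃ a > 0, ∀ T, 0 ≤ T →
    (∫ t in (T - a)..T, z t) ≤ 2 * ∫ t, h t := by
  have hM := R.M0
  refine ⟨1 / (2 * M), by positivity, fun T hT => ?_⟩
  set a := 1 / (2 * M) with ha
  have ha0 : 0 < a := by positivity
  have hMa : M * a = 1 / 2 := by rw [ha]; field_simp
  have h1 : (∫ s in Iic a, k s) ≤ 1 / 2 := by
    have : (∫ s in Iic a, k s) = ∫ s in Icc 0 a, k s := by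
      apply setIntegral_eq_of_subset_of_forall_sdiff_eq_zero measurableSet_Iic
      · intro s hs; exact hs.2
      · rintro s ⟨hs, hs'⟩
        refine R.k0 s ?_
        by_contra hc
        exact hs' ⟨by simpa using hc, hs⟩
    rw [this, ← hMa]
    calc (∫ s in Icc 0 a, k s) ≤ ∫ s in Icc 0 a, M :=
          setIntegral_mono_on R.ki.integrableOn (by simp) measurableSet_Icc (fun s _ => R.kM s)
      _ = M * a := by simp [ha0.le, mul_comm]
  have h2 : 1 / 2 ≤ ∫ s in Ioi a, k s := by
    have := integral_add_compl (measurableSet_Iic (a := a)) R.ki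
    rw [R.k1, compl_Iic] at this
    linarith
  have J0 : 0 ≤ ∫ t in (T - a)..T, z t :=
    intervalIntegral.integral_nonneg (by linarith) (fun t _ => R.zn t)
  have hI := (fub k z R.ki R.k0 R.k1 R.zm R.z0 R.zb T hT).1
  have h3 : (∫ s in Ioi a, k s * ∫ t in (T - a)..T, z t) ≤
      ∫ s in Ioi a, k s * ∫ t in (T - s)..T, z t := by
    refine setIntegral_mono_on (R.ki.mul_const _).integrableOn hI.integrableOn measurableSet_Ioi ?_
    intro s hs
    simp only [mem_Ioi] at hs
    refine mul_le_mul_of_nonneg_left ?_ (R.kn s)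
    have := intervalIntegral.integral_add_adjacent_intervals (R.zI (T-s) (T-a)) (R.zI (T-a) T)
    have : 0 ≤ ∫ t in (T - s)..(T-a), z t :=
      intervalIntegral.integral_nonneg (by linarith) (fun t _ => R.zn t)
    linarith
  have h4 : (∫ s in Ioi a, k s * ∫ t in (T - s)..T, z t) ≤ ∫ s, k s * ∫ t in (T - s)..T, z t := by
    refine setIntegral_le_integral hI (Eventually.of_forall fun s => ?_)
    rcases lt_or_ge s 0 with hs | hs
    · simp [R.k0 s hs]
    · exact mul_nonneg (R.kn s)
        (intervalIntegral.integral_nonneg (by linarith) (fun t _ => R.zn t))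
  rw [← R.cons T hT] at h4
  rw [integral_mul_const] at h3
  have := R.hle T hT
  nlinarith

lemma bdd (R : Ren k h z M δ) : ∃ B, 0 < B ∧ ∀ t, z t ≤ B := by
  obtain ⟨a, ha, hB⟩ := R.unit_bd
  set H := ∫ t, h t with hH
  have H0 : 0 ≤ H := integral_nonneg R.hn
  have hd := R.d0
  have hM := R.M0
  set q := Real.exp (-δ * a) with hq
  have q0 : 0 < q := Real.exp_pos _
  have q1 : q < 1 := by rw [hq, Real.exp_lt_one_iff]; nlinarith
  let E : ℝ → ℝ := fun t => ∫ s in (0:ℝ)..t, Real.exp (-δ * (t - s)) * z s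
  have hEI : ∀ t a b, IntervalIntegrable (fun s => Real.exp (-δ * (t - s)) * z s) volume a b := by
    intro t a b
    exact (R.zI a b).continuousOn_mul (by fun_prop)
  have hL : 0 ≤ 2 * H / (1 - q) := div_nonneg (by linarith) (by linarith)
  have base : ∀ t ≤ 0, E t ≤ 2 * H / (1 - q) := by
    intro t ht
    have : E t = 0 := by
      simp only [E]
      rw [intervalIntegral.integral_of_ge ht, integral_Ioc_eq_integral_Ioo,
        setIntegral_eq_zero_of_forall_eq_zero, neg_zero]
      intro s hs; simp [R.z0 s hs.2]
    rw [this]; exact hL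
  have step : ∀ n : ℕ, ∀ t ≤ n * a, E t ≤ 2 * H / (1 - q) := by
    intro n
    induction n with
    | zero => intro t ht; exact base t (by simpa using ht)
    | succ n ih =>
      intro t ht
      rcases le_or_gt t 0 with h0 | h0
      · exact base t h0
      have i1 := ih (t - a) (by push_cast at ht; linarith)
      have e1 : E t = q * E (t - a) + ∫ s in (t-a)..t, Real.exp (-δ * (t - s)) * z s := by
        simp only [E]
        rw [← intervalIntegral.integral_add_adjacent_intervals (hEI t 0 (t-a)) (hEI t (t-a) t),
          ← intervalIntegral.integral_const_mul]
        congr 2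
        ext s
        rw [hq, ← mul_assoc, ← Real.exp_add]; ring_nf
      have e2 : (∫ s in (t-a)..t, Real.exp (-δ * (t - s)) * z s) ≤ ∫ s in (t-a)..t, z s := by
        refine intervalIntegral.integral_mono_on (by linarith) (hEI _ _ _) (R.zI _ _) ?_
        intro s hs
        have : Real.exp (-δ * (t - s)) ≤ 1 := Real.exp_le_one_iff.2 (by nlinarith [hs.2])
        nlinarith [R.zn s]
      have e3 := hB t h0.le
      have e4 : q * (2 * H / (1 - q)) + 2 * H = 2 * H / (1 - q) := by
        have : 1 - q ≠ 0 := by linarith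
        field_simp; ring
      nlinarith
  refine ⟨M + M * (2 * H / (1 - q)), by positivity, fun t => ?_⟩
  rcases lt_or_ge t 0 with ht | ht
  · rw [R.z0 t ht]; positivity
  have hE : E t ≤ 2 * H / (1 - q) := by
    obtain ⟨n, hn⟩ := exists_nat_ge (t / a)
    exact step n t (by rwa [div_le_iff₀ ha] at hn)
  rw [R.eq t ht, conv_eq k z R.k0 R.z0 t ht]
  have hh : h t ≤ M := by
    refine (R.hb t ht).trans ?_
    have : Real.exp (-δ * t) ≤ 1 := Real.exp_le_one_iff.2 (by nlinarith)
    nlinarith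
  have hk : (∫ s in (0:ℝ)..t, k (t - s) * z s) ≤ M * E t := by
    simp only [E]
    rw [← intervalIntegral.integral_const_mul]
    refine intervalIntegral.integral_mono_on ht ?_ ((hEI _ _ _).const_mul _) ?_
    · refine ((R.zI 0 t).const_mul M).mono_fun
        ((R.km.comp (measurable_const.sub measurable_id)).mul R.zm).aestronglyMeasurable ?_
      refine Eventually.of_forall fun s => ?_
      simp only [norm_mul, Real.norm_eq_abs, abs_of_nonneg (R.kn _), abs_of_nonneg (R.zn _),
        abs_of_nonneg hM.le]
      exact mul_le_mul_of_nonneg_right (R.kM _) (R.zn _)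
    · intro s hs
      rw [← mul_assoc]
      exact mul_le_mul_of_nonneg_right (R.kb _ (by linarith [hs.2])) (R.zn s)
  nlinarith

lemma hM (R : Ren k h z M δ) (s : ℝ) : h s ≤ M := by
  rcases lt_or_ge s 0 with hs | hs
  · rw [R.h0 s hs]; exact R.M0.le
  · refine (R.hb s hs).trans ?_
    have : Real.exp (-δ * s) ≤ 1 := Real.exp_le_one_iff.2 (by nlinarith [R.d0])
    nlinarith [R.M0]

/-- bounded measurable times `k` is integrable -/
lemma kint (R : Ren k h z M δ) (w : ℝ → ℝ) (hw : Measurable w) (K : ℝ) (hK : ∀ s, |w s| ≤ K) :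
    Integrable (fun s => k s * w s) :=
  R.ki.mul_bdd (c := K) hw.aestronglyMeasurable (Eventually.of_forall hK)

lemma energy (R : Ren k h z M δ) :
    Integrable (fun p : ℝ × ℝ => k p.2 * (z p.1 - z (p.1 - p.2)) ^ 2)
      ((volume.restrict (Ioi 0)).prod volume) := by
  obtain ⟨B, B0, hB⟩ := R.bdd
  have hzabs : ∀ t, |z t| ≤ B := fun t => by rw [abs_of_nonneg (R.zn t)]; exact hB t
  have hz2 : ∀ t, |z t ^ 2| ≤ B ^ 2 := fun t => by
    rw [abs_pow]; exact pow_le_pow_left₀ (abs_nonneg _) (hzabs t) 2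
  have hdiff : ∀ t s, |z t - z s| ≤ B := fun t s => by
    rw [abs_le]; constructor <;> linarith [R.zn t, R.zn s, hB t, hB s]
  have hdiff2 : ∀ t s, |(z t - z s) ^ 2| ≤ B ^ 2 := fun t s => by
    rw [abs_pow]; exact pow_le_pow_left₀ (abs_nonneg _) (hdiff t s) 2
  have zsm : ∀ t : ℝ, Measurable (fun s => z (t - s)) := fun t =>
    R.zm.comp (measurable_const.sub measurable_id)
  have hD1 : ∀ t, Integrable (fun s => k s * (z t - z (t - s)) ^ 2) := fun t =>
    R.kint _ ((measurable_const.sub (zsm t)).pow_const 2) _ (fun s => hdiff2 t (t - s))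
  have hmeas : Measurable (fun p : ℝ × ℝ => k p.2 * (z p.1 - z (p.1 - p.2)) ^ 2) :=
    (R.km.comp measurable_snd).mul
      (((R.zm.comp measurable_fst).sub (R.zm.comp (measurable_fst.sub measurable_snd))).pow_const 2)
  have hDf : ∀ t, 0 ≤ t → (∫ s, k s * (z t - z (t - s)) ^ 2) =
      2 * (z t * h t) - (z t ^ 2 - ∫ s, k s * z (t - s) ^ 2) := by
    intro t ht
    have i1 : Integrable (fun s => k s * z (t - s)) := R.kint _ (zsm t) B (fun s => hzabs _)
    have i2 : Integrable (fun s => k s * z (t - s) ^ 2) :=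
      R.kint _ ((zsm t).pow_const 2) _ (fun s => hz2 _)
    have : ∀ s, k s * (z t - z (t - s)) ^ 2 =
        (z t ^ 2 * k s - (2 * z t) * (k s * z (t - s))) + k s * z (t - s) ^ 2 := by
      intro s; ring
    simp_rw [this]
    have i3 : Integrable (fun s => z t ^ 2 * k s - (2 * z t) * (k s * z (t - s))) :=
      (R.ki.const_mul _).sub (i1.const_mul _)
    rw [integral_add i3 i2,
      integral_sub (R.ki.const_mul _) (i1.const_mul _), integral_const_mul, integral_const_mul,
      R.k1]
    have e := R.eq t ht
    have e' : (∫ s, k s * z (t - s)) = z t - h t := by linarith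
    rw [e']; ring
  have hD0 : ∀ t, 0 ≤ ∫ s, k s * (z t - z (t - s)) ^ 2 := fun t =>
    integral_nonneg fun s => mul_nonneg (R.kn s) (sq_nonneg _)
  have z2b : ∀ T : ℝ, ∃ K : ℝ, ∀ t ≤ T, |z t ^ 2| ≤ K := fun T => ⟨B ^ 2, fun t _ => hz2 t⟩
  have z2m : Measurable (fun t => z t ^ 2) := R.zm.pow_const 2
  have z20 : ∀ s < 0, z s ^ 2 = 0 := fun s hs => by simp [R.z0 s hs]
  have zhI : ∀ T, IntervalIntegrable (fun t => z t * h t) volume 0 T := fun T =>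
    loc_int (fun t => z t * h t) (R.zm.mul R.hm) (fun T => ⟨B * M, fun t _ => by
      rw [abs_mul, abs_of_nonneg (R.zn t), abs_of_nonneg (R.hn t)]
      exact mul_le_mul (hB t) (R.hM t) (R.hn t) B0.le⟩) _ _
  rw [integrable_prod_iff hmeas.aestronglyMeasurable]
  refine ⟨Eventually.of_forall hD1, ?_⟩
  have hnorm : (fun t => ∫ s, ‖k s * (z t - z (t - s)) ^ 2‖) =
      fun t => ∫ s, k s * (z t - z (t - s)) ^ 2 := by
    ext t; congr 1; ext s
    exact abs_of_nonneg (mul_nonneg (R.kn s) (sq_nonneg _))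
  simp only
  rw [hnorm]
  have hFI : ∀ T, 0 ≤ T → IntervalIntegrable
      (fun t => 2 * (z t * h t) - (z t ^ 2 - ∫ s, k s * z (t - s) ^ 2)) volume 0 T := by
    intro T hT
    have f := fub k (fun t => z t ^ 2) R.ki R.k0 R.k1 z2m z20 z2b T hT
    exact ((zhI T).const_mul 2).sub ((loc_int _ z2m z2b 0 T).sub f.2.1)
  refine integrableOn_Ioi_of_intervalIntegral_norm_bounded (l := atTop) (b := fun n : ℕ => (n:ℝ))
    (2 * (B * ∫ t, h t)) 0 ?_ tendsto_natCast_atTop_atTop ?_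
  · intro n
    have := (intervalIntegrable_iff_integrableOn_Ioc_of_le (Nat.cast_nonneg n)).1
      (hFI n (Nat.cast_nonneg n))
    refine this.congr_fun ?_ measurableSet_Ioc
    intro t ht
    exact (hDf t ht.1.le).symm
  · refine Eventually.of_forall fun n => ?_
    set T : ℝ := (n : ℝ) with hTn
    have hT : 0 ≤ T := Nat.cast_nonneg n
    have f := fub k (fun t => z t ^ 2) R.ki R.k0 R.k1 z2m z20 z2b T hT
    have e1 : (∫ t in (0:ℝ)..T, ‖∫ s, k s * (z t - z (t - s)) ^ 2‖) =
        ∫ t in (0:ℝ)..T, (2 * (z t * h t) - (z t ^ 2 - ∫ s, k s * z (t - s) ^ 2)) := by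
      refine intervalIntegral.integral_congr fun t ht => ?_
      rw [uIcc_of_le hT] at ht
      rw [Real.norm_eq_abs, abs_of_nonneg (hD0 t), hDf t ht.1]
    rw [e1, intervalIntegral.integral_sub ((zhI T).const_mul 2)
      ((loc_int _ z2m z2b 0 T).sub f.2.1), f.2.2, intervalIntegral.integral_const_mul]
    have p1 : 0 ≤ ∫ s, k s * ∫ t in (T - s)..T, z t ^ 2 := by
      refine integral_nonneg fun s => ?_
      rcases lt_or_ge s 0 with hs | hs
      · simp [R.k0 s hs]
      · exact mul_nonneg (R.kn s)
          (intervalIntegral.integral_nonneg (by linarith) (fun t _ => sq_nonneg _))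
    have p2 : (∫ t in (0:ℝ)..T, z t * h t) ≤ B * ∫ t in (0:ℝ)..T, h t := by
      rw [← intervalIntegral.integral_const_mul]
      refine intervalIntegral.integral_mono_on hT (zhI T)
        (R.hi.intervalIntegrable.const_mul B) ?_
      intro t _
      exact mul_le_mul_of_nonneg_right (hB t) (R.hn t)
    have p3 := R.hle T hT
    nlinarith

lemma tend0 {c : ℝ → ℝ} (h0 : ∀ s, 0 ≤ c s) (hd : 0 < δ)
    (hb : ∀ s, 0 ≤ s → c s ≤ M * Real.exp (-δ * s)) : Tendsto c atTop (nhds 0) := by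
  have h1 : Tendsto (fun s => M * Real.exp (-δ * s)) atTop (nhds 0) := by
    have : Tendsto (fun s : ℝ => -δ * s) atTop atBot :=
      tendsto_id.const_mul_atTop_of_neg (by linarith)
    simpa using (Real.tendsto_exp_atBot.comp this).const_mul M
  refine tendsto_of_tendsto_of_tendsto_of_le_of_le' tendsto_const_nhds h1
    (Eventually.of_forall h0) ?_
  filter_upwards [eventually_ge_atTop 0] with s hs using hb s hs

lemma diff0 (R : Ren k h z M δ) (s : ℝ) (hs : 0 ≤ s)
    (hI : IntegrableOn (fun t => (z t - z (t - s)) ^ 2) (Ioi 0)) :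
    Tendsto (fun t => z t - z (t - s)) atTop (nhds 0) := by
  obtain ⟨B, B0, hB⟩ := R.bdd
  have hzabs : ∀ t, |z t| ≤ B := fun t => by rw [abs_of_nonneg (R.zn t)]; exact hB t
  set d : ℝ → ℝ := fun t => z t - z (t - s) with hd
  have dm : Measurable d := R.zm.sub (R.zm.comp (measurable_id.sub measurable_const))
  have hdb : ∀ t, |d t| ≤ B := fun t => by
    rw [abs_le]; simp only [hd]
    constructor <;> linarith [R.zn t, R.zn (t-s), hB t, hB (t-s)]
  have hd2 : ∀ t, |d t ^ 2| ≤ B ^ 2 := fun t => by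
    rw [abs_pow]; exact pow_le_pow_left₀ (abs_nonneg _) (hdb t) 2
  have hId : Integrable (fun t => d t ^ 2) := by
    have h1 : IntegrableOn (fun t => d t ^ 2) (Ici 0) :=
      (integrableOn_Ici_iff_integrableOn_Ioi (by simp)).2 hI
    rwa [integrableOn_iff_integrable_of_support_subset] at h1
    intro t ht
    by_contra hc
    have hc' : t < 0 := by simpa using hc
    exact ht (by simp [hd, R.z0 t hc', R.z0 (t - s) (by linarith)])
  have tsm : ∀ t : ℝ, Measurable (fun u : ℝ => t - u) := fun t => measurable_const.sub measurable_id
  -- conv of `k` with `d^2`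
  have hS : Tendsto (fun t => ∫ u, k u * d (t - u) ^ 2) atTop (nhds 0) := by
    have e : ∀ t, (∫ u, k u * d (t - u) ^ 2) = ∫ w, k (t - w) * d w ^ 2 := by
      intro t
      rw [← integral_sub_left_eq_self (fun u => k u * d (t - u) ^ 2) volume t]
      simp
    simp_rw [e]
    have := tendsto_integral_filter_of_dominated_convergence (μ := volume) (l := (atTop : Filter ℝ))
      (F := fun t w => k (t - w) * d w ^ 2) (f := fun _ => (0:ℝ)) (fun w => M * d w ^ 2) ?_ ?_
      (hId.const_mul M) ?_
    · simpa using this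
    · exact Eventually.of_forall fun t =>
        ((R.km.comp (tsm t)).mul (dm.pow_const 2)).aestronglyMeasurable
    · refine Eventually.of_forall fun t => Eventually.of_forall fun w => ?_
      rw [Real.norm_eq_abs, abs_of_nonneg (mul_nonneg (R.kn _) (sq_nonneg _))]
      exact mul_le_mul_of_nonneg_right (R.kM _) (sq_nonneg _)
    · refine Eventually.of_forall fun w => ?_
      have h1 : Tendsto (fun t : ℝ => t - w) atTop atTop :=
        tendsto_atTop_add_const_right _ (-w) tendsto_id
      simpa using ((tend0 R.kn R.d0 R.kb).comp h1).mul_const (d w ^ 2)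
  have hm : Tendsto (fun t => ∫ u, k u * d (t - u)) atTop (nhds 0) := by
    have hsq : Tendsto (fun t => (∫ u, k u * d (t - u)) ^ 2) atTop (nhds 0) := by
      refine squeeze_zero (fun t => sq_nonneg _) (fun t => ?_) hS
      set m := ∫ u, k u * d (t - u) with hm
      have i1 : Integrable (fun u => k u * d (t - u)) :=
        R.kint _ (dm.comp (tsm t)) B (fun s => hdb _)
      have i2 : Integrable (fun u => k u * d (t - u) ^ 2) :=
        R.kint _ ((dm.comp (tsm t)).pow_const 2) _ (fun s => hd2 _)
      have h0 : 0 ≤ ∫ u, k u * (d (t - u) - m) ^ 2 :=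
        integral_nonneg fun u => mul_nonneg (R.kn u) (sq_nonneg _)
      have e : ∀ u, k u * (d (t - u) - m) ^ 2 =
          (k u * d (t - u) ^ 2 - (2 * m) * (k u * d (t - u))) + m ^ 2 * k u := by
        intro u; ring
      simp_rw [e] at h0
      have i3 : Integrable (fun u => k u * d (t - u) ^ 2 - (2 * m) * (k u * d (t - u))) :=
        i2.sub (i1.const_mul _)
      rw [integral_add i3 (R.ki.const_mul _),
        integral_sub i2 (i1.const_mul _), integral_const_mul, integral_const_mul, R.k1, ← hm] at h0
      nlinarith
    have := (Real.continuous_sqrt.tendsto 0).comp hsq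
    simp only [Function.comp_def, Real.sqrt_sq_eq_abs, Real.sqrt_zero] at this
    exact (tendsto_zero_iff_abs_tendsto_zero _).2 this
  have hh := tend0 R.hn R.d0 R.hb
  have h1 : Tendsto (fun t : ℝ => t - s) atTop atTop :=
    tendsto_atTop_add_const_right _ (-s) tendsto_id
  have hfin := (hh.sub (hh.comp h1)).add hm
  simp only [sub_zero, add_zero] at hfin
  refine hfin.congr' ?_
  filter_upwards [eventually_ge_atTop s] with t ht
  have j1 : Integrable (fun u => k u * z (t - u)) :=
    R.kint _ (R.zm.comp (tsm t)) B (fun s => hzabs _)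
  have j2 : Integrable (fun u => k u * z (t - s - u)) :=
    R.kint _ (R.zm.comp (tsm (t - s))) B (fun s => hzabs _)
  have e : (∫ u, k u * d (t - u)) = (∫ u, k u * z (t - u)) - ∫ u, k u * z (t - s - u) := by
    rw [← integral_sub j1 j2]
    congr 1; ext u
    simp only [hd]
    rw [show t - u - s = t - s - u by ring]; ring
  simp only [Function.comp_def]
  rw [e, hd]
  simp only
  rw [R.eq t (by linarith), R.eq (t - s) (by linarith)]
  ring

/-- the subgroup of asymptotic periods -/
def per (z : ℝ → ℝ) : AddSubgroup ℝ where
  carrier := {s | Tendsto (fun t => z t - z (t - s)) atTop (nhds 0)}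
  zero_mem' := by simp
  add_mem' := by
    intro a b ha hb
    have h1 : Tendsto (fun t : ℝ => t - a) atTop atTop :=
      tendsto_atTop_add_const_right _ (-a) tendsto_id
    have := Tendsto.add ha (Tendsto.comp hb h1)
    simp only [add_zero] at this
    refine this.congr fun t => ?_
    simp only [Function.comp_def]
    rw [show t - (a + b) = t - a - b by ring]; ring
  neg_mem' := by
    intro a ha
    have h1 : Tendsto (fun t : ℝ => t + a) atTop atTop :=
      tendsto_atTop_add_const_right _ a tendsto_id
    have := (Tendsto.comp ha h1).neg
    simp only [neg_zero] at this
    refine this.congr fun t => ?_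
    simp

lemma per_all (R : Ren k h z M δ) (s : ℝ) :
    Tendsto (fun t => z t - z (t - s)) atTop (nhds 0) := by
  have hae : ∀ᵐ s, k s ≠ 0 → s ∈ per z := by
    filter_upwards [R.energy.prod_left_ae] with s hs hk
    have hs0 : 0 ≤ s := by
      by_contra hc
      exact hk (R.k0 s (by simpa using hc))
    refine R.diff0 s hs0 ?_
    have := hs.const_mul (k s)⁻¹
    refine this.congr (Eventually.of_forall fun t => ?_)
    simp only
    rw [← mul_assoc, inv_mul_cancel₀ hk, one_mul]
  let N : Set ℝ := toMeasurable volume {s | ¬ (k s ≠ 0 → s ∈ per z)}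
  have hN : volume N = 0 := by rw [measure_toMeasurable]; exact hae
  let P : Set ℝ := {s | k s ≠ 0} \ N
  have hPm : MeasurableSet P :=
    (R.km (measurableSet_singleton 0).compl).diff (measurableSet_toMeasurable _ _)
  have hPsub : ∀ s ∈ P, s ∈ per z := by
    rintro s ⟨hk, hn⟩
    by_contra hc
    exact hn (subset_toMeasurable _ _ (fun hh => hc (hh hk)))
  have hPpos : 0 < volume P := by
    rw [measure_sdiff_null hN, pos_iff_ne_zero]
    intro h0
    have : k =ᵐ[volume] 0 := h0
    have := integral_congr_ae this
    rw [R.k1] at this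
    simp at this
  have hnh := MeasureTheory.Measure.sub_mem_nhds_zero_of_addHaar_pos volume P hPm hPpos
  have hmem : (per z : Set ℝ) ∈ nhds (0:ℝ) := by
    refine mem_of_superset hnh ?_
    rintro _ ⟨a, ha, b, hb, rfl⟩
    exact (per z).sub_mem (hPsub a ha) (hPsub b hb)
  obtain ⟨ε, hε, hball⟩ := Metric.mem_nhds_iff.1 hmem
  obtain ⟨n, hn⟩ := exists_nat_gt (|s| / ε)
  have hn0 : (0:ℝ) < n := lt_of_le_of_lt (by positivity) hn
  have hin : s / n ∈ per z := by
    apply hball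
    rw [Metric.mem_ball, dist_zero_right, Real.norm_eq_abs, abs_div, abs_of_pos hn0,
      div_lt_iff₀ hn0]
    rw [div_lt_iff₀ hε] at hn
    linarith
  have := (per z).nsmul_mem hin n
  rw [nsmul_eq_mul, mul_div_cancel₀ _ hn0.ne'] at this
  exact this

lemma mu_int (R : Ren k h z M δ) : Integrable (fun s => s * k s) :=
  exp_int' k M δ R.d0 R.km R.k0 R.kn R.kb

lemma mu_pos (R : Ren k h z M δ) : 0 < ∫ s, s * k s := by
  have hnn : ∀ s, 0 ≤ s * k s := by
    intro s
    rcases lt_or_ge s 0 with h | h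
    · simp [R.k0 s h]
    · exact mul_nonneg h (R.kn s)
  refine lt_of_le_of_ne (integral_nonneg hnn) fun h0 => ?_
  have h1 := (integral_eq_zero_iff_of_nonneg hnn R.mu_int).1 h0.symm
  have : k =ᵐ[volume] 0 := by
    have hne : ∀ᵐ s : ℝ, s ≠ 0 := by simp [ae_iff]
    filter_upwards [h1, hne] with s hs hs0
    simpa [hs0] using hs
  have := integral_congr_ae this
  rw [R.k1] at this
  simp at this

theorem main (R : Ren k h z M δ) :
    Tendsto z atTop (nhds ((∫ t, h t) / ∫ s, s * k s)) := by
  obtain ⟨B, B0, hB⟩ := R.bdd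
  have hdiff : ∀ t s, |z t - z s| ≤ B := fun t s => by
    rw [abs_le]; constructor <;> linarith [R.zn t, R.zn s, hB t, hB s]
  have hμ := R.mu_pos
  set μ := ∫ s, s * k s with hmu
  have inner : ∀ T s, (∫ u in (0:ℝ)..s, (z (T - u) - z T)) = (∫ t in (T - s)..T, z t) - s * z T := by
    intro T s
    have := intervalIntegral.integral_comp_sub_left (a := 0) (b := s) z T
    have hii : IntervalIntegrable (fun u => z (T - u)) volume 0 s := by
      have := (R.zI T (T - s)).comp_sub_left T
      simpa using this
    rw [intervalIntegral.integral_sub hii (by simp), this]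
    simp
  have hΦ : Tendsto (fun T => ∫ s, k s * ∫ u in (0:ℝ)..s, (z (T - u) - z T)) atTop (nhds 0) := by
    have := tendsto_integral_filter_of_dominated_convergence (μ := volume) (l := (atTop : Filter ℝ))
      (F := fun T s => k s * ∫ u in (0:ℝ)..s, (z (T - u) - z T)) (f := fun _ => (0:ℝ))
      (fun s => B * (s * k s)) ?_ ?_ (R.mu_int.const_mul B) ?_
    · simpa using this
    · filter_upwards [eventually_ge_atTop 0] with T hT
      simp_rw [inner, mul_sub]
      have i1 := (fub k z R.ki R.k0 R.k1 R.zm R.z0 R.zb T hT).1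
      have i2 := R.mu_int.mul_const (z T)
      refine (i1.sub i2).aestronglyMeasurable.congr (Eventually.of_forall fun s => ?_)
      simp only [Pi.sub_apply]; ring
    · refine Eventually.of_forall fun T => Eventually.of_forall fun s => ?_
      rcases lt_or_ge s 0 with hs | hs
      · simp [R.k0 s hs]
      rw [norm_mul, Real.norm_eq_abs, abs_of_nonneg (R.kn s)]
      have := intervalIntegral.norm_integral_le_of_norm_le_const (a := 0) (b := s) (C := B)
        (f := fun u => z (T - u) - z T) (fun u _ => hdiff _ _)
      rw [sub_zero, abs_of_nonneg hs] at this
      calc _ ≤ k s * (B * s) := mul_le_mul_of_nonneg_left this (R.kn s)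
        _ = _ := by ring
    · refine Eventually.of_forall fun s => ?_
      have := intervalIntegral.tendsto_integral_filter_of_dominated_convergence (μ := volume)
        (l := (atTop : Filter ℝ)) (a := 0) (b := s)
        (F := fun T u => z (T - u) - z T) (f := fun _ => (0:ℝ)) (fun _ => B) ?_ ?_ (by simp) ?_
      · simpa using this.const_mul (k s)
      · exact Eventually.of_forall fun T =>
          ((R.zm.comp (measurable_const.sub measurable_id)).sub
            measurable_const).aestronglyMeasurable
      · exact Eventually.of_forall fun T => Eventually.of_forall fun u _ => hdiff _ _
      · refine Eventually.of_forall fun u _ => ?_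
        simpa using (R.per_all u).neg
  have hH : Tendsto (fun T => ∫ t in (0:ℝ)..T, h t) atTop (nhds (∫ t, h t)) := by
    have := intervalIntegral_tendsto_integral_Ioi 0 R.hi.integrableOn tendsto_id
    have e : (∫ t in Ioi (0:ℝ), h t) = ∫ t, h t := by
      rw [← integral_Ici_eq_integral_Ioi]
      apply setIntegral_eq_integral_of_forall_compl_eq_zero
      intro t ht
      exact R.h0 t (by simpa using ht)
    rw [e] at this
    exact this
  have hfin := (hH.sub hΦ).div_const μ
  rw [sub_zero] at hfin
  refine hfin.congr' ?_
  filter_upwards [eventually_ge_atTop 0] with T hT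
  simp_rw [inner, mul_sub]
  have i1 := (fub k z R.ki R.k0 R.k1 R.zm R.z0 R.zb T hT).1
  have i2 : Integrable (fun s => k s * (s * z T)) :=
    (R.mu_int.mul_const (z T)).congr (Eventually.of_forall fun s => by simp only; ring)
  have e2 : (∫ s, k s * (s * z T)) = μ * z T := by
    rw [hmu, ← integral_mul_const]
    congr 1; ext s; ring
  rw [integral_sub i1 i2, e2, ← R.cons T hT]
  field_simp
  ring

end Ren

lemma Gν_meas (α : ℝ) (ν : MeasureTheory.SignedMeasure ℝ) (ψ : ℝ → ℝ) (hψ : Measurable ψ) :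
    Measurable (Gν α ν ψ) := by
  have h : ∀ μ : Measure ℝ, SFinite μ → Measurable (fun t => ∫ u, ψ (t + u) ∂μ) := by
    intro μ _
    have : StronglyMeasurable (fun p : ℝ × ℝ => ψ (p.1 + p.2)) :=
      (hψ.comp (measurable_fst.add measurable_snd)).stronglyMeasurable
    exact this.integral_prod_right'.measurable
  exact (h _ inferInstance).sub (h _ inferInstance)

lemma Gν_bd (α : ℝ) (ν : MeasureTheory.SignedMeasure ℝ) (ψ : ℝ → ℝ) (C γ : ℝ) (hC : 0 ≤ C)
    (hγ : 0 < γ) (hb : ∀ t, -α ≤ t → |ψ t| ≤ C * Real.exp (-γ * t)) :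
    ∃ C', 0 < C' ∧ ∀ t, 0 ≤ t → (Gν α ν ψ t) ^ 2 ≤ C' * Real.exp (-(2 * γ) * t) := by
  have h : ∀ μ : Measure ℝ, IsFiniteMeasure μ → ∀ t, 0 ≤ t →
      |∫ u in Icc (-α) 0, ψ (t + u) ∂μ| ≤
        (C * Real.exp (γ * α) * (μ.restrict (Icc (-α) 0)).real univ) * Real.exp (-γ * t) := by
    intro μ _ t ht
    have := norm_integral_le_of_norm_le_const (μ := μ.restrict (Icc (-α) 0))
      (f := fun u => ψ (t + u)) (C := C * Real.exp (γ * α) * Real.exp (-γ * t)) ?_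
    · calc _ ≤ _ := this
        _ = _ := by ring
    · filter_upwards [ae_restrict_mem measurableSet_Icc] with u hu
      refine (hb (t + u) (by linarith [hu.1])).trans ?_
      rw [mul_assoc, ← Real.exp_add]
      gcongr
      nlinarith [hu.1]
  set A := C * Real.exp (γ * α) *
    (ν.toJordanDecomposition.posPart.restrict (Icc (-α) 0)).real univ with hA
  set A' := C * Real.exp (γ * α) *
    (ν.toJordanDecomposition.negPart.restrict (Icc (-α) 0)).real univ with hA'
  have A0 : 0 ≤ A := by positivity
  have A0' : 0 ≤ A' := by positivity
  refine ⟨(A + A' + 1) ^ 2, by positivity, fun t ht => ?_⟩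
  have h1 := h ν.toJordanDecomposition.posPart inferInstance t ht
  have h2 := h ν.toJordanDecomposition.negPart inferInstance t ht
  rw [← hA] at h1
  rw [← hA'] at h2
  have h3 : |Gν α ν ψ t| ≤ (A + A' + 1) * Real.exp (-γ * t) := by
    unfold Gν
    refine (abs_sub _ _).trans ?_
    nlinarith [Real.exp_pos (-γ * t)]
  calc (Gν α ν ψ t) ^ 2 = |Gν α ν ψ t| ^ 2 := (sq_abs _).symm
    _ ≤ ((A + A' + 1) * Real.exp (-γ * t)) ^ 2 := pow_le_pow_left₀ (abs_nonneg _) h3 2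
    _ = (A + A' + 1) ^ 2 * (Real.exp (-γ * t) * Real.exp (-γ * t)) := by ring
    _ = _ := by rw [← Real.exp_add]; ring_nf

lemma int_ind (F F' : ℝ → ℝ) (hF : ∀ t, 0 ≤ t → F t = F' t) (hF0 : ∀ t < 0, F t = 0) :
    (∫ t, F t) = ∫ t in Ioi (0:ℝ), F' t := by
  rw [← integral_Ici_eq_integral_Ioi]
  rw [← setIntegral_eq_integral_of_forall_compl_eq_zero (s := Ici (0:ℝ))]
  · exact setIntegral_congr_fun measurableSet_Ici fun t ht => hF t ht
  · intro t ht
    exact hF0 t (by simpa using ht)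

/-- Intermediate step in the proof of Theorem 3.2(c): in the excessive case,
with the Malthusian parameter κ, the exponentially discounted solution of the
renewal equation converges. -/
theorem stmt5 (α : ℝ) (hα : 0 ≤ α) (ν : MeasureTheory.SignedMeasure ℝ)
    (C γ : ℝ) (hC : 0 < C) (hγ : 0 < γ)
    (r : ℝ → ℝ) (hrmeas : Measurable r) (hrneg : ∀ u < (0:ℝ), r u = 0)
    (hrdecay : ∀ t ≥ (0:ℝ), |r t| ≤ C * Real.exp (-γ * t))
    (x : ℝ → ℝ) (hxcont : Continuous x)
    (hxdecay : ∀ t ≥ (0:ℝ), |x t| ≤ C * Real.exp (-γ * t))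
    (f g : ℝ → ℝ)
    (hf : ∀ t ≥ (0:ℝ), f t = (Gν α ν x t) ^ 2)
    (hg : ∀ t ≥ (0:ℝ), g t = (Gν α ν r t) ^ 2)
    (y : ℝ → ℝ) (hymeas : Measurable y) (hynn : ∀ t ≥ (0:ℝ), 0 ≤ y t)
    (hybdd : ∀ T : ℝ, ∃ K : ℝ, ∀ t ∈ Set.Icc (0:ℝ) T, y t ≤ K)
    (hren : ∀ t ≥ (0:ℝ), y t = f t + ∫ s in (0:ℝ)..t, g (t - s) * y s)
    (hexcessive : 1 < (∫ s in Set.Ioi (0:ℝ), g s))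
    (κ : ℝ) (hκ : 0 < κ)
    (hmalthus : (∫ s in Set.Ioi (0:ℝ), Real.exp (-κ * s) * g s) = 1) :
    MeasureTheory.IntegrableOn (fun s => s * (Real.exp (-κ * s) * g s)) (Set.Ioi 0) ∧
    0 < (∫ s in Set.Ioi (0:ℝ), s * (Real.exp (-κ * s) * g s)) ∧
    Tendsto (fun t => Real.exp (-κ * t) * y t) atTop (nhds
      ((∫ s in Set.Ioi (0:ℝ), Real.exp (-κ * s) * f s)
        / (∫ s in Set.Ioi (0:ℝ), s * (Real.exp (-κ * s) * g s)))) := by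
  obtain ⟨C₁, hC₁, hr2⟩ := Gν_bd α ν r C γ hC.le hγ (by
    intro t _
    rcases lt_or_ge t 0 with h | h
    · rw [hrneg t h, abs_zero]; positivity
    · exact hrdecay t h)
  obtain ⟨K, hK⟩ := (isCompact_Icc (a := -α) (b := 0)).exists_bound_of_continuousOn
    hxcont.continuousOn
  obtain ⟨C₂, hC₂, hx2⟩ := Gν_bd α ν x (max C K) γ (hC.le.trans (le_max_left _ _)) hγ (by
    intro t hta
    have hm : 0 ≤ max C K := hC.le.trans (le_max_left _ _)
    rcases lt_or_ge t 0 with h | h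
    · have h1 := hK t ⟨hta, h.le⟩
      have h2 : 1 ≤ Real.exp (-γ * t) := Real.one_le_exp (by nlinarith)
      rw [Real.norm_eq_abs] at h1
      have h3 := le_max_right C K
      nlinarith
    · refine (hxdecay t h).trans ?_
      gcongr
      exact le_max_left _ _)
  set k : ℝ → ℝ := (Ici (0:ℝ)).indicator (fun s => Real.exp (-κ * s) * (Gν α ν r s) ^ 2) with hkdef
  set h : ℝ → ℝ := (Ici (0:ℝ)).indicator (fun s => Real.exp (-κ * s) * (Gν α ν x s) ^ 2) with hhdef
  set z : ℝ → ℝ := (Ici (0:ℝ)).indicator (fun s => Real.exp (-κ * s) * y s) with hzdef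
  have em : Measurable (fun s : ℝ => Real.exp (-κ * s)) := by fun_prop
  have k0 : ∀ s < 0, k s = 0 := fun s hs => indicator_of_notMem (by simpa using hs) _
  have h0 : ∀ s < 0, h s = 0 := fun s hs => indicator_of_notMem (by simpa using hs) _
  have z0 : ∀ s < 0, z s = 0 := fun s hs => indicator_of_notMem (by simpa using hs) _
  have kp : ∀ s, 0 ≤ s → k s = Real.exp (-κ * s) * g s := fun s hs => by
    rw [hg s hs]; exact indicator_of_mem (show s ∈ Ici (0:ℝ) from hs) _
  have hp : ∀ s, 0 ≤ s → h s = Real.exp (-κ * s) * f s := fun s hs => by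
    rw [hf s hs]; exact indicator_of_mem (show s ∈ Ici (0:ℝ) from hs) _
  have zp : ∀ s, 0 ≤ s → z s = Real.exp (-κ * s) * y s := fun s hs =>
    indicator_of_mem (show s ∈ Ici (0:ℝ) from hs) _
  have hbd : ∀ (G2 : ℝ → ℝ) (D : ℝ), D ≤ max C₁ C₂ →
      (∀ t, 0 ≤ t → G2 t ≤ D * Real.exp (-(2 * γ) * t)) → ∀ t, 0 ≤ t →
      Real.exp (-κ * t) * G2 t ≤ max C₁ C₂ * Real.exp (-(κ + 2 * γ) * t) := by
    intro G2 D hD hG t ht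
    calc Real.exp (-κ * t) * G2 t
        ≤ Real.exp (-κ * t) * (max C₁ C₂ * Real.exp (-(2 * γ) * t)) := by
          have := hG t ht
          have h2 : D * Real.exp (-(2 * γ) * t) ≤ max C₁ C₂ * Real.exp (-(2 * γ) * t) := by gcongr
          exact mul_le_mul_of_nonneg_left (this.trans h2) (Real.exp_pos _).le
      _ = max C₁ C₂ * (Real.exp (-κ * t) * Real.exp (-(2 * γ) * t)) := by ring
      _ = _ := by rw [← Real.exp_add]; ring_nf
  have R : Ren k h z (max C₁ C₂) (κ + 2 * γ) :=
    { M0 := lt_of_lt_of_le hC₁ (le_max_left _ _)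
      d0 := by linarith
      km := (em.mul ((Gν_meas α ν r hrmeas).pow_const 2)).indicator measurableSet_Ici
      hm := (em.mul ((Gν_meas α ν x hxcont.measurable).pow_const 2)).indicator measurableSet_Ici
      zm := (em.mul hymeas).indicator measurableSet_Ici
      k0 := k0
      h0 := h0
      z0 := z0
      kn := indicator_nonneg fun s _ => by positivity
      hn := indicator_nonneg fun s _ => by positivity
      zn := indicator_nonneg fun s hs => mul_nonneg (Real.exp_pos _).le (hynn s hs)
      kb := by
        intro s hs
        rw [kp s hs]
        exact hbd g C₁ (le_max_left _ _) (fun t ht => by rw [hg t ht]; exact hr2 t ht) s hs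
      hb := by
        intro s hs
        rw [hp s hs]
        exact hbd f C₂ (le_max_right _ _) (fun t ht => by rw [hf t ht]; exact hx2 t ht) s hs
      zb := by
        intro T
        obtain ⟨K, hK⟩ := hybdd T
        refine ⟨max K 0, fun t ht => ?_⟩
        rcases lt_or_ge t 0 with h | h
        · rw [z0 t h]; simp
        · rw [zp t h, abs_of_nonneg (mul_nonneg (Real.exp_pos _).le (hynn t h))]
          have h1 : Real.exp (-κ * t) ≤ 1 := Real.exp_le_one_iff.2 (by nlinarith)
          have h2 := hK t ⟨h, ht⟩
          have h3 := hynn t h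
          refine le_trans ?_ (le_max_left _ _)
          nlinarith
      k1 := by rw [← hmalthus]; exact int_ind _ _ kp k0
      eq := by
        intro t ht
        rw [conv_eq k z k0 z0 t ht, zp t ht, hp t ht, hren t ht, mul_add,
          ← intervalIntegral.integral_const_mul]
        congr 1
        refine intervalIntegral.integral_congr fun s hs => ?_
        rw [uIcc_of_le ht] at hs
        have e : Real.exp (-κ * t) = Real.exp (-κ * (t - s)) * Real.exp (-κ * s) := by
          rw [← Real.exp_add]; ring_nf
        rw [kp (t - s) (by linarith [hs.2]), zp s hs.1, e]
        ring }
  have eμ : (∫ s, s * k s) = ∫ s in Ioi (0:ℝ), s * (Real.exp (-κ * s) * g s) :=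
    int_ind _ _ (fun s hs => by rw [kp s hs]) (fun s hs => by rw [k0 s hs, mul_zero])
  have eh : (∫ s, h s) = ∫ s in Ioi (0:ℝ), Real.exp (-κ * s) * f s := int_ind _ _ hp h0
  rw [← eμ, ← eh]
  refine ⟨?_, R.mu_pos, ?_⟩
  · refine R.mu_int.integrableOn.congr_fun (fun s hs => ?_) measurableSet_Ioi
    simp only
    rw [kp s (le_of_lt hs)]
  · refine R.main.congr' ?_
    filter_upwards [eventually_ge_atTop 0] with t ht using zp t ht
end
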